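/- arXiv:2001.11940 — 3 statements merged into one kernel-verified Lean document; each statement's English description precedes it below -/
import Mathlib

section
/- Let A, B, C ⊆ V be disjoint. If [A] and [B] are d-separated given [C] in the mixture DAG D_μ, then X_A ⊥ X_B | X_C holds in the mixture distribution p_μ. -/
set_option maxHeartbeats 1000000

attribute [local instance] Classical.propDecidable

universe u

/-- A mixed graph: directed edges `dir u v` (u → v) and bidirected edges `bidir u v` (u ↔ v). -/
structure MixedGraph (α : Type u) where
  dir : α → α → Prop
  bidir : α → α → Prop

namespace MixedGraph

variable {α : Type u}

/-- There is a bidirected edge between `u` and `v`. -/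
def Bid (G : MixedGraph α) (u v : α) : Prop := G.bidir u v ∨ G.bidir v u

/-- `u` is an ancestor of `v`: `u = v` or there is a directed path from `u` to `v`. -/
def Anc (G : MixedGraph α) : α → α → Prop := Relation.ReflTransGen G.dir

/-- No directed cycles. -/
def Acyclic (G : MixedGraph α) : Prop := ∀ u v, G.dir u v → ¬ G.Anc v u

/-- An ancestral graph: acyclic, and no endpoint of a bidirected edge is an ancestor
of the other endpoint. -/
def Ancestral (G : MixedGraph α) : Prop :=
  G.Acyclic ∧ ∀ u v, G.Bid u v → ¬ G.Anc u v

/-- `G` is a DAG: acyclic with no bidirected edges. -/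
def IsDAG (G : MixedGraph α) : Prop := G.Acyclic ∧ ∀ u v, ¬ G.bidir u v

/-- `u` and `v` are adjacent (joined by some edge). -/
def Adj (G : MixedGraph α) (u v : α) : Prop :=
  G.dir u v ∨ G.dir v u ∨ G.Bid u v

/-- A walk in a mixed graph, recording for each step which kind of edge is traversed:
`consF` traverses `a → b`, `consB` traverses `b → a` (from `a`'s side),
`consBi` traverses `a ↔ b`. -/
inductive Walk (G : MixedGraph α) : α → α → Type u
  | nil (a : α) : Walk G a a
  | consF {a b c : α} (h : G.dir a b) (w : Walk G b c) : Walk G a c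
  | consB {a b c : α} (h : G.dir b a) (w : Walk G b c) : Walk G a c
  | consBi {a b c : α} (h : G.Bid a b) (w : Walk G b c) : Walk G a c

namespace Walk

variable {G : MixedGraph α}

/-- The list of vertices visited by a walk. -/
def support {a b : α} (w : G.Walk a b) : List α :=
  match a, b, w with
  | a, _, .nil _ => [a]
  | a, _, .consF _ w' => a :: w'.support
  | a, _, .consB _ w' => a :: w'.support
  | a, _, .consBi _ w' => a :: w'.support

/-- A path is a walk whose vertices are pairwise distinct. -/
def IsPath {a b : α} (w : G.Walk a b) : Prop := w.support.Nodup

/-- The first edge of the walk has an arrowhead at the initial vertex. -/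
def arrowAtStart {a b : α} (w : G.Walk a b) : Prop :=
  match a, b, w with
  | _, _, .nil _ => False
  | _, _, .consF _ _ => False
  | _, _, .consB _ _ => True
  | _, _, .consBi _ _ => True

/-- The last edge of the walk has an arrowhead at the final vertex. -/
def arrowAtEnd {a b : α} (w : G.Walk a b) : Prop :=
  match a, b, w with
  | _, _, .nil _ => False
  | _, _, .consF _ (.nil _) => True
  | _, _, .consB _ (.nil _) => False
  | _, _, .consBi _ (.nil _) => True
  | _, _, .consF _ w' => w'.arrowAtEnd
  | _, _, .consB _ w' => w'.arrowAtEnd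
  | _, _, .consBi _ w' => w'.arrowAtEnd

/-- The last edge of the walk has a tail at the final vertex. -/
def tailAtEnd {a b : α} (w : G.Walk a b) : Prop :=
  match a, b, w with
  | _, _, .nil _ => False
  | _, _, .consF _ (.nil _) => False
  | _, _, .consB _ (.nil _) => True
  | _, _, .consBi _ (.nil _) => False
  | _, _, .consF _ w' => w'.tailAtEnd
  | _, _, .consB _ w' => w'.tailAtEnd
  | _, _, .consBi _ w' => w'.tailAtEnd

/-- Number of bidirected edges traversed by the walk. -/
def bidirCount {a b : α} (w : G.Walk a b) : ℕ :=
  match a, b, w with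
  | _, _, .nil _ => 0
  | _, _, .consF _ w' => w'.bidirCount
  | _, _, .consB _ w' => w'.bidirCount
  | _, _, .consBi _ w' => w'.bidirCount + 1

end Walk

/-- The condition for an internal vertex `a` of a path to be active given `C`:
if it is a collider it must be an ancestor of a node of `C`,
and if it is a non-collider it must lie outside `C`. -/
def activeVertex (G : MixedGraph α) (C : Set α) (a : α) (collider : Prop) : Prop :=
  (collider ∧ ∃ z ∈ C, G.Anc a z) ∨ (¬ collider ∧ a ∉ C)

namespace Walk

variable {G : MixedGraph α}

/-- Given that the edge entering the initial vertex of `w` from the previous part of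
the path has an arrowhead at it iff `arrowIn`, this checks the activity condition at
that vertex (trivial if `w` is the empty walk, i.e. the vertex is an endpoint). -/
def junctionOK (C : Set α) (arrowIn : Prop) {a b : α} (w : G.Walk a b) : Prop :=
  match a, b, w with
  | _, _, .nil _ => True
  | a, _, .consF _ _ => G.activeVertex C a (arrowIn ∧ False)
  | a, _, .consB _ _ => G.activeVertex C a (arrowIn ∧ True)
  | a, _, .consBi _ _ => G.activeVertex C a (arrowIn ∧ True)

/-- The walk is d-connecting given `C`: every collider on it is an ancestor of a node
in `C`, and every non-collider on it lies outside `C`. -/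
def DConn (C : Set α) {a b : α} (w : G.Walk a b) : Prop :=
  match a, b, w with
  | _, _, .nil _ => True
  | _, _, .consF _ w' => w'.junctionOK C True ∧ w'.DConn C
  | _, _, .consB _ w' => w'.junctionOK C False ∧ w'.DConn C
  | _, _, .consBi _ w' => w'.junctionOK C True ∧ w'.DConn C

end Walk

/-- `A` and `B` are d-separated given `C`: no path between a node of `A` and a node
of `B` is d-connecting given `C`. -/
def DSep (G : MixedGraph α) (A B C : Set α) : Prop :=
  ∀ ⦃a⦄, a ∈ A → ∀ ⦃b⦄, b ∈ B → ∀ w : G.Walk a b, w.IsPath → ¬ w.DConn C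

/-- A maximal ancestral graph: ancestral, and every pair of distinct non-adjacent
vertices is d-separated given some subset of the remaining vertices. -/
def IsMAG (G : MixedGraph α) : Prop :=
  G.Ancestral ∧ ∀ u v, u ≠ v → ¬ G.Adj u v →
    ∃ C : Set α, u ∉ C ∧ v ∉ C ∧ G.DSep {u} {v} C

end MixedGraph

open MixedGraph

/-- Ancestor relation of a directed edge relation. -/
def AncE {β : Type u} (E : β → β → Prop) : β → β → Prop := Relation.ReflTransGen E

/-- `u` and `v` are distinct children of the marginalized vertex `y = Sum.inr ()`. -/
def chPair {α : Type u} (E : (α ⊕ Unit) → (α ⊕ Unit) → Prop) (u v : α) : Prop :=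
  u ≠ v ∧ E (Sum.inr ()) (Sum.inl u) ∧ E (Sum.inr ()) (Sum.inl v)

/-- The marginal ancestral graph of the DAG `E` on `α ⊕ Unit` with respect to the vertex
`y = Sum.inr ()` (Algorithm 1): keep directed edges among `α`; add `u ↔ v` for distinct
children `u, v` of `y`; for `t → u ∈ E` and added `u ↔ v` with `u` an ancestor of `v`,
add `t → v`; finally replace each added `u ↔ v` with `u ∈ an(v)` by `u → v`. -/
def marginalMAG {α : Type u} (E : (α ⊕ Unit) → (α ⊕ Unit) → Prop) : MixedGraph α where
  dir t v :=
    E (Sum.inl t) (Sum.inl v)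
    ∨ (∃ u, E (Sum.inl t) (Sum.inl u) ∧ chPair E u v ∧ AncE E (Sum.inl u) (Sum.inl v))
    ∨ (chPair E t v ∧ AncE E (Sum.inl t) (Sum.inl v))
  bidir u v :=
    chPair E u v ∧ ¬ AncE E (Sum.inl u) (Sum.inl v) ∧ ¬ AncE E (Sum.inl v) (Sum.inl u)

/-- The mixture DAG on `(Fin K × V) ⊕ Unit`, with `y = Sum.inr ()`: it consists of the
`K` component DAGs placed side by side, plus edges from `y` into every copy of every
node of `W`. -/
def mixtureDAG {V : Type u} (K : ℕ) (E : Fin K → V → V → Prop) (W : Set V) :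
    MixedGraph ((Fin K × V) ⊕ Unit) where
  dir x z :=
    (∃ j u v, E j u v ∧ x = Sum.inl (j, u) ∧ z = Sum.inl (j, v)) ∨
    (∃ j v, v ∈ W ∧ x = Sum.inr () ∧ z = Sum.inl (j, v))
  bidir _ _ := False

/-- The sub-DAG of the mixture DAG induced on the `j`-th copy `V⁽ʲ⁾ ∪ {y}`,
presented as an edge relation on `V ⊕ Unit`. -/
def componentDAGEdges {V : Type u} {K : ℕ} (E : Fin K → V → V → Prop) (W : Set V)
    (j : Fin K) : (V ⊕ Unit) → (V ⊕ Unit) → Prop := fun x z =>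
  (∃ u v, E j u v ∧ x = Sum.inl u ∧ z = Sum.inl v) ∨
  (∃ v, v ∈ W ∧ x = Sum.inr () ∧ z = Sum.inl v)

/-- The component MAG `M⁽ʲ⁾`: the marginal ancestral graph with respect to `y` of the
sub-DAG of the mixture DAG induced on `V⁽ʲ⁾ ∪ {y}`. -/
def componentMAG {V : Type u} {K : ℕ} (E : Fin K → V → V → Prop) (W : Set V)
    (j : Fin K) : MixedGraph V :=
  marginalMAG (componentDAGEdges E W j)

/-- The mixture MAG `M_μ`: the marginal ancestral graph of the mixture DAG with
respect to `y`. -/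
def mixtureMAG {V : Type u} (K : ℕ) (E : Fin K → V → V → Prop) (W : Set V) :
    MixedGraph (Fin K × V) :=
  marginalMAG (mixtureDAG K E W).dir

/-- The union graph `M_∪`: `u → v` iff `u → v` in some `M⁽ʲ⁾`, `u ↔ v` iff `u ↔ v` in
some `M⁽ʲ⁾`. -/
def unionGraph {V : Type u} {K : ℕ} (E : Fin K → V → V → Prop) (W : Set V) :
    MixedGraph V where
  dir u v := ∃ j, (componentMAG E W j).dir u v
  bidir u v := ∃ j, (componentMAG E W j).bidir u v

/-- Poset compatibility of the component MAGs: a strict partial order on `V` such that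
ancestry in every `M⁽ʲ⁾` respects the order and endpoints of bidirected edges of every
`M⁽ʲ⁾` are incomparable. -/
def PosetCompatible {V : Type u} {K : ℕ} (E : Fin K → V → V → Prop) (W : Set V) : Prop :=
  ∃ r : V → V → Prop, IsStrictOrder V r ∧
    (∀ j u v, (componentMAG E W j).Anc u v → u ≠ v → r u v) ∧
    (∀ j u v, (componentMAG E W j).bidir u v → ¬ r u v ∧ ¬ r v u)

/-- `[A]`: all `K` copies of the nodes of `A`, as a subset of the vertices of the
mixture DAG. -/
def liftSet {V : Type u} (K : ℕ) (A : Set V) : Set ((Fin K × V) ⊕ Unit) :=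
  {x | ∃ j a, a ∈ A ∧ x = Sum.inl (j, a)}

/-- `[A]` as a subset of `Fin K × V` (the vertices of the mixture MAG `M_μ`). -/
def copySet {V : Type u} (K : ℕ) (A : Set V) : Set (Fin K × V) := {p | p.2 ∈ A}

/-- `A⁽ʲ⁾` as a subset of the vertices `V ⊕ Unit` of a component sub-DAG. -/
def inlSet {V : Type u} (A : Set V) : Set (V ⊕ Unit) := {x | ∃ a ∈ A, x = Sum.inl a}

/-- Node `v` has different parent sets in different component DAGs. -/
def ParentsVary {V : Type u} {K : ℕ} (E : Fin K → V → V → Prop) (v : V) : Prop :=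
  ¬ ∀ j k u, E j u v ↔ E k u v

section Prob

variable {V : Type} [Fintype V] [DecidableEq V] {σ : V → Type} [∀ v, Fintype (σ v)]

/-- The marginal probability of the event that the coordinates in `S` agree with `x`. -/
noncomputable def marg (p : (∀ v, σ v) → ℝ) (S : Set V) (x : ∀ v, σ v) : ℝ :=
  ∑ y : ∀ v, σ v, if ∀ v ∈ S, y v = x v then p y else 0

/-- The conditional probability `p(x_S | x_C)`. -/
noncomputable def condProb (p : (∀ v, σ v) → ℝ) (S C : Set V) (x : ∀ v, σ v) : ℝ :=
  marg p (S ∪ C) x / marg p C x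

/-- Conditional independence `X_A ⟂ X_B | X_C` in `p`:
`p(x_A, x_B | x_C) = p(x_A | x_C) · p(x_B | x_C)` whenever `p(x_C) > 0`. -/
def CondIndep (p : (∀ v, σ v) → ℝ) (A B C : Set V) : Prop :=
  ∀ x, 0 < marg p C x →
    condProb p (A ∪ B) C x = condProb p A C x * condProb p B C x

/-- A strictly positive probability distribution on the product state space. -/
def IsPositiveDist (p : (∀ v, σ v) → ℝ) : Prop :=
  (∀ x, 0 < p x) ∧ ∑ x, p x = 1

/-- `p` factorizes according to the DAG with directed edge relation `Ed`:
`p(x) = ∏_v p(x_v | x_{pa(v)})`. -/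
def Factorizes (p : (∀ v, σ v) → ℝ) (Ed : V → V → Prop) : Prop :=
  ∀ x, p x = ∏ v, condProb p {v} {u | Ed u v} x

/-- Node `v` is invariant: its conditional given its parents is the same function in
all the component distributions. -/
def InvariantNode {K : ℕ} (E : Fin K → V → V → Prop)
    (p : Fin K → (∀ v, σ v) → ℝ) (v : V) : Prop :=
  ∀ j k x, condProb (p j) {v} {u | E j u v} x = condProb (p k) {v} {u | E k u v} x

end Prob

namespace MixedGraph

variable {α : Type u} {G : MixedGraph α}

/-- Every suffix of a d-connecting path is a d-connecting path. -/
theorem Walk.exists_suffix {C : Set α} (hb : ∀ u v, ¬ G.Bid u v) {a b : α} (w : G.Walk a b)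
    (hp : w.IsPath) (hw : w.DConn C) (s : Prop) (hs : w.junctionOK C s)
    (x : α) (hx : x ∈ w.support) :
    ∃ w2 : G.Walk x b, w2.IsPath ∧ w2.DConn C ∧ ∃ s, w2.junctionOK C s := by
  induction w generalizing s with
  | nil a =>
    simp only [Walk.support, List.mem_singleton] at hx
    subst hx
    exact ⟨.nil x, hp, hw, s, hs⟩
  | @consF a c b h w ih =>
    by_cases hax : x = a
    · subst hax
      exact ⟨.consF h w, hp, hw, s, hs⟩
    · simp only [Walk.IsPath, Walk.support, List.nodup_cons, List.mem_cons] at hp hx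
      simp only [Walk.DConn] at hw
      exact ih hp.2 hw.2 True hw.1 (hx.resolve_left hax)
  | @consB a c b h w ih =>
    by_cases hax : x = a
    · subst hax
      exact ⟨.consB h w, hp, hw, s, hs⟩
    · simp only [Walk.IsPath, Walk.support, List.nodup_cons, List.mem_cons] at hp hx
      simp only [Walk.DConn] at hw
      exact ih hp.2 hw.2 False hw.1 (hx.resolve_left hax)
  | @consBi a c b h w ih => exact absurd h (hb _ _)

/-- Following a d-connecting walk entered through an arrowhead: its start is an ancestor of
any vertex on it, or an ancestor of the conditioning set. -/
theorem Walk.anc_or {C : Set α} (hb : ∀ u v, ¬ G.Bid u v) {c b : α} (w : G.Walk c b)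
    (hw : w.DConn C) (hs : w.junctionOK C True) (x : α) (hx : x ∈ w.support) :
    G.Anc c x ∨ ∃ z ∈ C, G.Anc c z := by
  induction w with
  | nil a =>
    simp only [Walk.support, List.mem_singleton] at hx
    subst hx
    exact Or.inl Relation.ReflTransGen.refl
  | @consF a c b h w ih =>
    simp only [Walk.support, List.mem_cons] at hx
    simp only [Walk.DConn] at hw
    rcases hx with rfl | hx
    · exact Or.inl Relation.ReflTransGen.refl
    · rcases ih hw.2 hw.1 hx with h1 | ⟨z, hz, h1⟩
      · exact Or.inl (Relation.ReflTransGen.head h h1)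
      · exact Or.inr ⟨z, hz, Relation.ReflTransGen.head h h1⟩
  | @consB a c b h w ih =>
    simp only [Walk.junctionOK, activeVertex, and_self, true_and, not_true_eq_false,
      false_and, or_false] at hs
    exact Or.inr hs
  | @consBi a c b h w ih => exact absurd h (hb _ _)

/-- A d-connecting walk can be shortened to a d-connecting path. -/
theorem Walk.exists_path {C : Set α} (hb : ∀ u v, ¬ G.Bid u v) (hac : G.Acyclic)
    {a b : α} (w : G.Walk a b) (hw : w.DConn C) :
    ∃ w2 : G.Walk a b, w2.IsPath ∧ w2.DConn C ∧
      ∀ s, w.junctionOK C s → w2.junctionOK C s := by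
  induction w with
  | nil a => exact ⟨.nil a, by simp [Walk.IsPath, Walk.support], trivial, fun _ h => h⟩
  | @consF a c b h w ih =>
    simp only [Walk.DConn] at hw
    obtain ⟨w1, hp, hd, hj⟩ := ih hw.2
    have hj1 := hj _ hw.1
    by_cases hx : a ∈ w1.support
    · obtain ⟨w2, hp2, hd2, s2, hs2⟩ := w1.exists_suffix hb hp hd True hj1 a hx
      refine ⟨w2, hp2, hd2, fun s hs => ?_⟩
      have hanc : ∃ z ∈ C, G.Anc a z := by
        rcases w1.anc_or hb hd hj1 a hx with h1 | ⟨z, hz, h1⟩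
        · exact absurd h1 (hac _ _ h)
        · exact ⟨z, hz, Relation.ReflTransGen.head h h1⟩
      cases w2 with
      | nil => trivial
      | consF h' w' =>
        simp only [Walk.junctionOK, activeVertex, and_false, false_and, false_or,
          not_false_eq_true, true_and] at hs2 ⊢
        exact hs2
      | consB h' w' =>
        simp only [Walk.junctionOK, activeVertex, and_false, false_and, false_or,
          not_false_eq_true, true_and, and_true] at hs ⊢
        by_cases h : s
        · exact Or.inl ⟨h, hanc⟩
        · exact Or.inr ⟨h, hs⟩
      | consBi h => exact absurd h (hb _ _)
    · refine ⟨.consF h w1, ?_, ⟨hj1, hd⟩, fun s hs => hs⟩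
      simp only [Walk.IsPath, Walk.support, List.nodup_cons]
      exact ⟨hx, hp⟩
  | @consB a c b h w ih =>
    simp only [Walk.DConn] at hw
    obtain ⟨w1, hp, hd, hj⟩ := ih hw.2
    have hj1 := hj _ hw.1
    by_cases hx : a ∈ w1.support
    · obtain ⟨w2, hp2, hd2, s2, hs2⟩ := w1.exists_suffix hb hp hd False hj1 a hx
      refine ⟨w2, hp2, hd2, fun s hs => ?_⟩
      cases w2 with
      | nil => trivial
      | consF h' w' =>
        simp only [Walk.junctionOK, activeVertex, and_false, false_and, false_or,
          not_false_eq_true, true_and] at hs2 ⊢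
        exact hs2
      | consB h' w' => exact hs
      | consBi h => exact absurd h (hb _ _)
    · refine ⟨.consB h w1, ?_, ⟨hj1, hd⟩, fun s hs => hs⟩
      simp only [Walk.IsPath, Walk.support, List.nodup_cons]
      exact ⟨hx, hp⟩
  | @consBi a c b h w ih => exact absurd h (hb _ _)

/-- The ancestors of `D` outside `C`. -/
def ancOut (G : MixedGraph α) (D C : Set α) (x : α) : Prop :=
  (∃ z ∈ D, G.Anc x z) ∧ x ∉ C

/-- Adjacency in the moral graph of the ancestors of `D`, with `C` removed. -/
def moralStep (G : MixedGraph α) (D C : Set α) (x z : α) : Prop :=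
  G.ancOut D C x ∧ G.ancOut D C z ∧
    (G.dir x z ∨ G.dir z x ∨ ∃ u ∈ C, G.dir x u ∧ G.dir z u)

theorem moralStep_symm {D C : Set α} {x z : α} (h : G.moralStep D C x z) :
    G.moralStep D C z x := by
  obtain ⟨h1, h2, h3⟩ := h
  refine ⟨h2, h1, ?_⟩
  rcases h3 with h | h | ⟨u, hu, h, h'⟩
  · exact Or.inr (Or.inl h)
  · exact Or.inl h
  · exact Or.inr (Or.inr ⟨u, hu, h', h⟩)

theorem moralReach_symm {D C : Set α} {x z : α}
    (h : Relation.ReflTransGen (G.moralStep D C) x z) :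
    Relation.ReflTransGen (G.moralStep D C) z x := by
  induction h with
  | refl => exact Relation.ReflTransGen.refl
  | tail _ h ih => exact Relation.ReflTransGen.head (moralStep_symm h) ih

theorem moralReach_mono {G' : MixedGraph α} (hle : ∀ x z, G.dir x z → G'.dir x z) {D C : Set α}
    {x z : α} (h : Relation.ReflTransGen (G.moralStep D C) x z) :
    Relation.ReflTransGen (G'.moralStep D C) x z := by
  have hanc : ∀ x, G.ancOut D C x → G'.ancOut D C x := by
    rintro x ⟨⟨z, hz, h⟩, hx⟩
    exact ⟨⟨z, hz, Relation.ReflTransGen.mono hle _ _ h⟩, hx⟩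
  refine Relation.ReflTransGen.mono ?_ _ _ h
  rintro x z ⟨h1, h2, h3⟩
  refine ⟨hanc _ h1, hanc _ h2, ?_⟩
  rcases h3 with h | h | ⟨u, hu, h, h'⟩
  · exact Or.inl (hle _ _ h)
  · exact Or.inr (Or.inl (hle _ _ h))
  · exact Or.inr (Or.inr ⟨u, hu, hle _ _ h, hle _ _ h'⟩)

theorem Walk.junctionOK_false {C : Set α} {x b : α} (hx : x ∉ C) (w : G.Walk x b) :
    w.junctionOK C False := by
  cases w <;> simp [Walk.junctionOK, activeVertex, hx]

theorem Walk.junctionOK_anc {C : Set α} {x b : α} (s : Prop) (hx : x ∉ C)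
    (hz : ∃ z ∈ C, G.Anc x z) (w : G.Walk x b) :
    w.junctionOK C s := by
  by_cases h : s <;> cases w <;> simp [Walk.junctionOK, activeVertex, hx, h, hz]

/-- A directed path leaving `x` outside the ancestors of `C` can be prepended (reversed). -/
theorem exists_walk_prepend {C : Set α} {x a b : α} (h : G.Anc x a)
    (hx : ¬ ∃ z ∈ C, G.Anc x z) (w : G.Walk x b) (hw : w.DConn C) :
    ∃ w2 : G.Walk a b, w2.DConn C := by
  induction h with
  | refl => exact ⟨w, hw⟩
  | @tail c d h1 h2 ih =>
    obtain ⟨w2, hw2⟩ := ih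
    exact ⟨.consB h2 w2, w2.junctionOK_false (fun hc => hx ⟨c, hc, h1⟩), hw2⟩

/-- A directed path outside the ancestors of `C` is a d-connecting walk. -/
theorem exists_walk_directed {C : Set α} {x b : α} (h : G.Anc x b)
    (hx : ¬ ∃ z ∈ C, G.Anc x z) :
    ∃ w : G.Walk x b, w.DConn C ∧ w.junctionOK C True := by
  induction h using Relation.ReflTransGen.head_induction_on with
  | refl => exact ⟨.nil b, trivial, trivial⟩
  | @head c d h1 h2 ih =>
    obtain ⟨w, hw, hj⟩ := ih (fun ⟨z, hz, h⟩ => hx ⟨z, hz, Relation.ReflTransGen.head h1 h⟩)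
    refine ⟨.consF h1 w, ⟨hj, hw⟩, ?_⟩
    have : c ∉ C := fun hc => hx ⟨c, hc, Relation.ReflTransGen.refl⟩
    simp [Walk.junctionOK, activeVertex, this]

/-- d-separation implies separation in the moral graph. -/
theorem not_moralReach {A B C : Set α} (hb : ∀ u v, ¬ G.Bid u v) (hac : G.Acyclic)
    (hsep : G.DSep A B C) {a b : α} (ha : a ∈ A) (hbB : b ∈ B) :
    ¬ Relation.ReflTransGen (G.moralStep (A ∪ B ∪ C) C) a b := by
  have hno : ∀ a ∈ A, ∀ b ∈ B, ∀ w : G.Walk a b, ¬ w.DConn C := by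
    intro a ha b hbB w hw
    obtain ⟨w2, h1, h2, -⟩ := w.exists_path hb hac hw
    exact hsep ha hbB w2 h1 h2
  intro h
  have key : ∀ x, Relation.ReflTransGen (G.moralStep (A ∪ B ∪ C) C) b x →
      ∃ b' ∈ B, ∃ w : G.Walk x b', w.DConn C := by
    intro x hx
    induction hx with
    | refl => exact ⟨b, hbB, .nil b, trivial⟩
    | @tail x z h1 h2 ih =>
      obtain ⟨b', hb', w, hw⟩ := ih
      obtain ⟨⟨⟨t, ht, hxt⟩, hxC⟩, hz, hstep⟩ := h2
      rcases hstep with h | h | ⟨u, hu, h, h'⟩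
      · exact ⟨b', hb', .consB h w, w.junctionOK_false hxC, hw⟩
      · by_cases hC : ∃ z ∈ C, G.Anc x z
        · exact ⟨b', hb', .consF h w, w.junctionOK_anc _ hxC hC, hw⟩
        · rcases ht with (ht | ht) | ht
          · obtain ⟨w2, hw2⟩ := exists_walk_prepend hxt hC w hw
            exact absurd hw2 (hno _ ht _ hb' w2)
          · obtain ⟨w2, hw2, hj2⟩ := exists_walk_directed hxt hC
            exact ⟨t, ht, .consF h w2, hj2, hw2⟩
          · exact absurd ⟨t, ht, hxt⟩ hC
      · refine ⟨b', hb', .consF h' (.consB h w), ?_, w.junctionOK_false hxC, hw⟩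
        exact Or.inl ⟨⟨trivial, trivial⟩, u, hu, Relation.ReflTransGen.refl⟩
  obtain ⟨b', hb', w, hw⟩ := key a (moralReach_symm h)
  exact hno a ha b' hb' w hw

end MixedGraph

section ProbLemmas

set_option linter.unusedSectionVars false

variable {V : Type} [Fintype V] [DecidableEq V] {σ : V → Type} [∀ v, Fintype (σ v)]

/-- `F` depends only on the coordinates in `S`. -/
def DepOn (F : (∀ v, σ v) → ℝ) (S : Set V) : Prop :=
  ∀ x y : ∀ v, σ v, (∀ v ∈ S, x v = y v) → F x = F y

theorem DepOn.mono {F : (∀ v, σ v) → ℝ} {S T : Set V} (h : DepOn F S) (hST : S ⊆ T) :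
    DepOn F T := fun x y hxy => h x y fun v hv => hxy v (hST hv)

theorem DepOn.inter {F : (∀ v, σ v) → ℝ} {S T : Set V} (h : DepOn F S) (h' : DepOn F T) :
    DepOn F (S ∩ T) := by
  intro x y hxy
  have h1 : F x = F (fun v => if v ∈ S then x v else y v) := by
    apply h; intro v hv; simp [hv]
  rw [h1]
  apply h'
  intro v hv
  by_cases hS : v ∈ S
  · simp [hS, hxy v ⟨hS, hv⟩]
  · simp [hS]

theorem DepOn.iInter {ι : Type} [Finite ι] {F : (∀ v, σ v) → ℝ} {S : ι → Set V}
    (h : ∀ i, DepOn F (S i)) : DepOn F {v | ∀ i, v ∈ S i} := by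
  have := Fintype.ofFinite ι
  have key : ∀ s : Finset ι, DepOn F {v | ∀ i ∈ s, v ∈ S i} := by
    intro s
    induction s using Finset.induction_on with
    | empty =>
      intro x y hxy
      rw [show x = y from funext fun v => hxy v (by simp)]
    | insert i s hi ih =>
      refine ((h i).inter ih).mono ?_
      rintro v ⟨h1, h2⟩ k hk
      rcases Finset.mem_insert.1 hk with rfl | hk
      · exact h1
      · exact h2 k hk
  exact (key Finset.univ).mono fun v hv i => hv i (Finset.mem_univ i)

theorem DepOn.mul {F G : (∀ v, σ v) → ℝ} {S : Set V} (h : DepOn F S) (h' : DepOn G S) :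
    DepOn (fun x => F x * G x) S := fun x y hxy => by
  simp only [h x y hxy, h' x y hxy]

theorem DepOn.prod {ι : Type} {s : Finset ι} {F : ι → (∀ v, σ v) → ℝ} {S : Set V}
    (h : ∀ i ∈ s, DepOn (F i) S) : DepOn (fun x => ∏ i ∈ s, F i x) S := fun x y hxy =>
  Finset.prod_congr rfl fun i hi => h i hi x y hxy

theorem DepOn.sum {ι : Type} {s : Finset ι} {F : ι → (∀ v, σ v) → ℝ} {S : Set V}
    (h : ∀ i ∈ s, DepOn (F i) S) : DepOn (fun x => ∑ i ∈ s, F i x) S := fun x y hxy =>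
  Finset.sum_congr rfl fun i hi => h i hi x y hxy

theorem marg_depOn (F : (∀ v, σ v) → ℝ) (S : Set V) : DepOn (marg F S) S := by
  intro x y hxy
  unfold marg
  refine Finset.sum_congr rfl fun z _ => ?_
  have : (∀ v ∈ S, z v = x v) ↔ (∀ v ∈ S, z v = y v) :=
    forall₂_congr fun v hv => by rw [hxy v hv]
  simp only [this]

/-- Summing out coordinates on which `F` does not depend does not create dependence. -/
theorem marg_depOn' {F : (∀ v, σ v) → ℝ} {T : Set V} (h : DepOn F T) (S : Set V) :
    DepOn (marg F S) T := by
  intro x x' hxx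
  unfold marg
  rw [← Finset.sum_filter, ← Finset.sum_filter]
  refine Finset.sum_bij' (fun y _ => fun v => if v ∈ S then x' v else y v)
    (fun y _ => fun v => if v ∈ S then x v else y v) ?_ ?_ ?_ ?_ ?_
  · intro y _
    simp +contextual
  · intro y _
    simp +contextual
  · intro y hy
    simp only [Finset.mem_filter, Finset.mem_univ, true_and] at hy
    funext v
    by_cases hv : v ∈ S <;> simp [hv, hy]
  · intro y hy
    simp only [Finset.mem_filter, Finset.mem_univ, true_and] at hy
    funext v
    by_cases hv : v ∈ S <;> simp [hv, hy]
  · intro y hy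
    simp only [Finset.mem_filter, Finset.mem_univ, true_and] at hy
    apply h
    intro v hv
    by_cases hS : v ∈ S
    · simp [hS, hy v hS, hxx v hv]
    · simp [hS]

theorem marg_mul_left {G F : (∀ v, σ v) → ℝ} {S : Set V} (h : DepOn G S) (x : ∀ v, σ v) :
    marg (fun y => G y * F y) S x = G x * marg F S x := by
  unfold marg
  rw [Finset.mul_sum]
  refine Finset.sum_congr rfl fun z _ => ?_
  split_ifs with hz
  · simp only [h z x hz]
  · simp

theorem marg_mul_right {G F : (∀ v, σ v) → ℝ} {S : Set V} (h : DepOn G S) (x : ∀ v, σ v) :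
    marg (fun y => F y * G y) S x = marg F S x * G x := by
  rw [mul_comm, ← marg_mul_left h]
  simp only [mul_comm]

theorem marg_marg {F : (∀ v, σ v) → ℝ} {S T : Set V} (h : S ∪ T = Set.univ) (x : ∀ v, σ v) :
    marg (marg F S) T x = marg F (S ∩ T) x := by
  unfold marg
  have h1 : ∀ y : ∀ v, σ v, (if ∀ v ∈ T, y v = x v then
      ∑ z : ∀ v, σ v, (if ∀ v ∈ S, z v = y v then F z else 0) else 0)
      = ∑ z : ∀ v, σ v, if (∀ v ∈ T, y v = x v) ∧ (∀ v ∈ S, z v = y v) then F z else 0 := by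
    intro y
    by_cases hy : ∀ v ∈ T, y v = x v
    · simp only [if_pos hy]
      refine Finset.sum_congr rfl fun z _ => ?_
      by_cases hz : ∀ v ∈ S, z v = y v
      · rw [if_pos hz, if_pos ⟨hy, hz⟩]
      · rw [if_neg hz, if_neg (fun h => hz h.2)]
    · rw [if_neg hy]
      symm
      exact Finset.sum_eq_zero fun z _ => if_neg (fun h => hy h.1)
  rw [Finset.sum_congr rfl fun y _ => h1 y, Finset.sum_comm]
  refine Finset.sum_congr rfl fun z _ => ?_
  by_cases hz : ∀ v ∈ S ∩ T, z v = x v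
  · rw [if_pos hz, Finset.sum_eq_single (fun v => if v ∈ S then z v else x v)]
    · rw [if_pos]
      refine ⟨fun v hv => ?_, fun v hv => ?_⟩
      · by_cases hS : v ∈ S
        · simp [hS, hz v ⟨hS, hv⟩]
        · simp [hS]
      · simp [hv]
    · intro y _ hy
      apply if_neg
      rintro ⟨h2, h3⟩
      apply hy
      funext v
      by_cases hS : v ∈ S
      · simp [hS, h3 v hS]
      · have : v ∈ T := by
          have : v ∈ S ∪ T := by rw [h]; trivial
          exact this.resolve_left hS
        simp [hS, h2 v this]
    · simp
  · rw [if_neg hz]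
    refine Finset.sum_eq_zero fun y _ => if_neg ?_
    rintro ⟨h2, h3⟩
    exact hz fun v hv => (h3 v hv.1).trans (h2 v hv.2)

/-- Summing out two disjoint groups of coordinates from a product. -/
theorem marg_mul {G H : (∀ v, σ v) → ℝ} {M N : Set V} (hMN : Disjoint M N)
    (hG : DepOn G Nᶜ) (hH : DepOn H Mᶜ) (x : ∀ v, σ v) :
    marg (fun y => G y * H y) (M ∪ N)ᶜ x = marg G Mᶜ x * marg H Nᶜ x := by
  have hu : Mᶜ ∪ Nᶜ = Set.univ := by
    rw [← Set.compl_inter, hMN.inter_eq, Set.compl_empty]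
  have h1 : marg (fun y => G y * H y) Mᶜ = fun x => marg G Mᶜ x * H x := by
    funext x
    exact marg_mul_right hH x
  rw [Set.compl_union, ← marg_marg hu, h1, marg_mul_left (marg_depOn' hG _)]

theorem marg_univ (F : (∀ v, σ v) → ℝ) (x : ∀ v, σ v) : marg F Set.univ x = F x := by
  unfold marg
  rw [Finset.sum_eq_single x]
  · simp
  · intro y _ hy
    apply if_neg
    intro h
    exact hy (funext fun v => h v trivial)
  · simp

theorem marg_pos {F : (∀ v, σ v) → ℝ} (hF : ∀ x, 0 < F x) (S : Set V) (x : ∀ v, σ v) :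
    0 < marg F S x := by
  unfold marg
  refine Finset.sum_pos' (fun y _ => ?_) ⟨x, Finset.mem_univ x, ?_⟩
  · split_ifs
    · exact (hF y).le
    · exact le_rfl
  · simp [hF x]

/-- Kernels on a finite set of nodes sum to one. -/
theorem marg_prod_kernels {f : V → (∀ v, σ v) → ℝ} {Ed : V → V → Prop}
    (hdep : ∀ v, DepOn (f v) (insert v {u | Ed u v}))
    (hsum : ∀ v x, marg (f v) {v}ᶜ x = 1)
    (hwf : WellFounded (fun a b => Ed b a)) (N : Finset V) (x : ∀ v, σ v) :
    marg (fun y => ∏ v ∈ N, f v y) (N : Set V)ᶜ x = 1 := by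
  induction hn : N.card generalizing N x with
  | zero =>
    rw [Finset.card_eq_zero] at hn
    subst hn
    simp only [Finset.coe_empty, Set.compl_empty, marg_univ, Finset.prod_empty]
  | succ n ih =>
    have hne : (N : Set V).Nonempty := by
      rw [Finset.coe_nonempty, ← Finset.card_pos]; omega
    obtain ⟨v, hv, hmin⟩ := hwf.has_min _ hne
    have hv' : v ∈ N := hv
    have e1 : (fun y => ∏ u ∈ N, f u y) = fun y => (∏ u ∈ N.erase v, f u y) * f v y := by
      funext y
      exact (Finset.prod_erase_mul N (fun u => f u y) hv').symm
    have e2 : (N : Set V)ᶜ = {v}ᶜ ∩ ((N.erase v : Finset V) : Set V)ᶜ := by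
      rw [← Set.compl_union]
      congr 1
      ext u
      simp only [Finset.coe_erase, Set.mem_union, Set.mem_singleton_iff, Set.mem_sdiff,
        Finset.mem_coe]
      by_cases h : u = v
      · simp [h, hv']
      · simp [h]
    have e3 : marg (fun y => (∏ u ∈ N.erase v, f u y) * f v y) {v}ᶜ
        = fun y => ∏ u ∈ N.erase v, f u y := by
      funext y
      rw [marg_mul_left (DepOn.prod ?_), hsum, mul_one]
      intro u hu
      have hu' := Finset.mem_erase.1 hu
      refine (hdep u).mono ?_
      rintro t (rfl | ht)
      · exact hu'.1
      · intro htv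
        rw [Set.mem_singleton_iff] at htv
        subst htv
        exact hmin u hu'.2 ht
    rw [e1, e2, ← marg_marg, e3]
    · refine ih _ _ ?_
      rw [Finset.card_erase_of_mem hv']; omega
    · ext u
      simp only [Finset.coe_erase, Set.mem_union, Set.mem_compl_iff, Set.mem_singleton_iff,
        Set.mem_sdiff, Set.mem_univ, iff_true]
      tauto

/-- A product form of the joint marginal gives conditional independence. -/
theorem condIndep_of_product {P g h : (∀ v, σ v) → ℝ} {A B C : Set V}
    (hAB : Disjoint A B) (hAC : Disjoint A C) (hBC : Disjoint B C)
    (hg : DepOn g (A ∪ C)) (hh : DepOn h (B ∪ C))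
    (hP : ∀ x, marg P (A ∪ B ∪ C) x = g x * h x) : CondIndep P A B C := by
  intro x hx
  have hP' : marg P (A ∪ B ∪ C) = fun x => g x * h x := funext hP
  have dAB := Set.disjoint_left.1 hAB
  have dAC := Set.disjoint_left.1 hAC
  have dBC := Set.disjoint_left.1 hBC
  have gB : DepOn g Bᶜ := hg.mono fun v hv hB => by
    rcases hv with hv | hv
    · exact dAB hv hB
    · exact dBC hB hv
  have hA : DepOn h Aᶜ := hh.mono fun v hv hA => by
    rcases hv with hv | hv
    · exact dAB hA hv
    · exact dAC hA hv
  have e1 : marg P (A ∪ C) x = g x * marg h Bᶜ x := by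
    have : A ∪ C = (A ∪ B ∪ C) ∩ Bᶜ := by
      ext v
      have := @dAB v; have := @dBC v
      simp only [Set.mem_union, Set.mem_inter_iff, Set.mem_compl_iff]; tauto
    rw [this, ← marg_marg, hP', marg_mul_left gB]
    ext v; simp only [Set.mem_union, Set.mem_compl_iff, Set.mem_univ, iff_true]; tauto
  have e2 : marg P (B ∪ C) x = marg g Aᶜ x * h x := by
    have : B ∪ C = (A ∪ B ∪ C) ∩ Aᶜ := by
      ext v
      have := @dAB v; have := @dAC v
      simp only [Set.mem_union, Set.mem_inter_iff, Set.mem_compl_iff]; tauto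
    rw [this, ← marg_marg, hP', marg_mul_right hA]
    ext v; simp only [Set.mem_union, Set.mem_compl_iff, Set.mem_univ, iff_true]; tauto
  have e3 : marg P C x = marg g Aᶜ x * marg h Bᶜ x := by
    have : C = (A ∪ B ∪ C) ∩ (A ∪ B)ᶜ := by
      ext v
      have := @dBC v; have := @dAC v
      simp only [Set.mem_union, Set.mem_inter_iff, Set.mem_compl_iff]; tauto
    rw [this, ← marg_marg, hP', marg_mul hAB gB hA]
    ext v; simp only [Set.mem_union, Set.mem_compl_iff, Set.mem_univ, iff_true]; tauto
  unfold condProb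
  rw [hP x, e1, e2]
  rw [e3] at hx ⊢
  have h1 : marg g Aᶜ x ≠ 0 := fun h => by simp [h] at hx
  have h2 : marg h Bᶜ x ≠ 0 := fun h => by simp [h] at hx
  field_simp

/-- The conditionals of a positive distribution are kernels. -/
theorem condProb_kernel {P : (∀ v, σ v) → ℝ} (hP : ∀ x, 0 < P x) {v : V} {pa : Set V}
    (hv : v ∉ pa) (x : ∀ v, σ v) : marg (condProb P {v} pa) {v}ᶜ x = 1 := by
  have e : condProb P {v} pa = fun x => marg P ({v} ∪ pa) x * (marg P pa x)⁻¹ := by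
    funext x; rw [condProb, div_eq_mul_inv]
  have hd : DepOn (fun x => (marg P pa x)⁻¹) {v}ᶜ := by
    intro x y hxy
    simp only
    rw [marg_depOn P pa x y fun u hu => hxy u (by rintro rfl; exact hv hu)]
  have hs : pa = ({v} ∪ pa) ∩ {v}ᶜ := by
    ext u
    simp only [Set.mem_union, Set.mem_inter_iff, Set.mem_compl_iff, Set.mem_singleton_iff]
    by_cases h : u = v
    · subst h; simp [hv]
    · simp [h]
  rw [e, marg_mul_right hd, marg_marg, ← hs, mul_inv_cancel₀ (marg_pos hP _ _).ne']
  ext u; simp only [Set.mem_union, Set.mem_compl_iff, Set.mem_univ, iff_true]; tauto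

theorem condProb_depOn (P : (∀ v, σ v) → ℝ) (v : V) (pa : Set V) :
    DepOn (condProb P {v} pa) (insert v pa) := by
  intro x y hxy
  unfold condProb
  rw [marg_depOn P ({v} ∪ pa) x y hxy, marg_depOn P pa x y fun u hu => hxy u (Or.inr hu)]

theorem marg_sum {ι : Type} (s : Finset ι) (c : ι → ℝ) (P : ι → (∀ v, σ v) → ℝ) (S : Set V)
    (x : ∀ v, σ v) :
    marg (fun y => ∑ j ∈ s, c j * P j y) S x = ∑ j ∈ s, c j * marg (P j) S x := by
  unfold marg
  simp only [Finset.mul_sum]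
  rw [Finset.sum_comm]
  refine Finset.sum_congr rfl fun y _ => ?_
  split_ifs <;> simp

end ProbLemmas

section Core

set_option linter.unusedSectionVars false

variable {V : Type} [Fintype V] [DecidableEq V] {σ : V → Type} [∀ v, Fintype (σ v)]

/-- The product form of the joint marginal of a mixture, from a suitable splitting. -/
theorem product_form {K : ℕ} {E : Fin K → V → V → Prop} {f : Fin K → V → (∀ v, σ v) → ℝ}
    (hdep : ∀ j v, DepOn (f j v) (insert v {u | E j u v}))
    (hsum : ∀ j v x, marg (f j v) {v}ᶜ x = 1)
    (hwf : ∀ j, WellFounded (fun a b => E j b a))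
    (c : Fin K → ℝ) (j0 : Fin K) {A B C S Q : Set V} {An : Fin K → Set V}
    (hAB : Disjoint A B)
    (hB : ∀ j, B ⊆ An j) (hC : ∀ j, C ⊆ An j)
    (hanc : ∀ j u v, v ∈ An j → E j u v → u ∈ An j)
    (hAS : A ⊆ S) (hSB : Disjoint S B) (hSC : Disjoint S C) (hSAn : ∀ j, S ⊆ An j)
    (hQ1 : ∀ j v, v ∈ Q → v ∈ An j ∧ insert v {u | E j u v} ⊆ S ∪ C)
    (hQ2 : ∀ j v, v ∈ An j → v ∉ Q → insert v {u | E j u v} ⊆ Sᶜ)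
    (hQ3 : ∀ j k v, v ∈ Q → f j v = f k v) :
    ∃ g h : (∀ v, σ v) → ℝ, DepOn g (A ∪ C) ∧ DepOn h (B ∪ C) ∧
      ∀ x, marg (fun y => ∑ j, c j * ∏ v, f j v y) (A ∪ B ∪ C) x = g x * h x := by
  set G : (∀ v, σ v) → ℝ := fun y => ∏ v with v ∈ Q, f j0 v y with hG
  set H : Fin K → (∀ v, σ v) → ℝ := fun j y => ∏ v with v ∈ An j ∧ v ∉ Q, f j v y with hH
  set N : Fin K → Set V := fun j => An j \ (S ∪ B ∪ C) with hN
  have dSB := Set.disjoint_left.1 hSB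
  have dSC := Set.disjoint_left.1 hSC
  have dAB := Set.disjoint_left.1 hAB
  have dG : DepOn G (S ∪ C) := DepOn.prod fun v hv => by
    simp only [Finset.mem_filter, Finset.mem_univ, true_and] at hv
    exact (hdep j0 v).mono (hQ1 j0 v hv).2
  have dH : ∀ j, DepOn (H j) (Sᶜ ∩ An j) := fun j => DepOn.prod fun v hv => by
    simp only [Finset.mem_filter, Finset.mem_univ, true_and] at hv
    refine (hdep j v).mono (Set.subset_inter (hQ2 j v hv.1 hv.2) ?_)
    rintro u (rfl | hu)
    · exact hv.1
    · exact hanc j u v hv.1 hu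
  have split : ∀ j y, ∏ v, f j v y = (G y * H j y) * ∏ v with v ∉ An j, f j v y := by
    intro j y
    rw [← Finset.prod_filter_mul_prod_filter_not Finset.univ (fun v => v ∈ An j)]
    congr 1
    rw [← Finset.prod_filter_mul_prod_filter_not _ (fun v => v ∈ Q), Finset.filter_filter,
      Finset.filter_filter]
    congr 1
    have : (Finset.univ.filter fun v => v ∈ An j ∧ v ∈ Q) = Finset.univ.filter fun v => v ∈ Q := by
      ext v
      simp only [Finset.mem_filter, Finset.mem_univ, true_and]
      exact ⟨fun h => h.2, fun h => ⟨(hQ1 j v h).1, h⟩⟩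
    rw [this]
    refine Finset.prod_congr rfl fun v hv => ?_
    simp only [Finset.mem_filter, Finset.mem_univ, true_and] at hv
    rw [hQ3 j j0 v hv]
  have main : ∀ j x, marg (fun y => ∏ v, f j v y) (A ∪ B ∪ C) x
      = marg G (S \ A)ᶜ x * marg (H j) (N j)ᶜ x := by
    intro j x
    have e1 : A ∪ B ∪ C = An j ∩ ((S \ A) ∪ N j)ᶜ := by
      ext v
      have h1 := @hB j v; have h2 := @hC j v; have h3 := @hAS v; have h4 := @hSAn j v
      have h5 := @dSB v; have h6 := @dSC v
      simp only [hN, Set.mem_union, Set.mem_inter_iff, Set.mem_compl_iff, Set.mem_sdiff]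
      tauto
    have e2 : An j ∪ ((S \ A) ∪ N j)ᶜ = Set.univ := by
      ext v
      have h4 := @hSAn j v
      simp only [hN, Set.mem_union, Set.mem_compl_iff, Set.mem_sdiff, Set.mem_univ, iff_true]
      tauto
    have e3 : marg (fun y => ∏ v, f j v y) (An j) = fun y => G y * H j y := by
      funext x
      simp only [split j]
      rw [marg_mul_left]
      · have := marg_prod_kernels (hdep j) (hsum j) (hwf j) (Finset.univ.filter fun v => v ∉ An j) x
        have e : ((Finset.univ.filter fun v => v ∉ An j : Finset V) : Set V)ᶜ = An j := by
          ext v; simp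
        rw [e] at this
        rw [this, mul_one]
      · exact DepOn.mul (dG.mono (Set.union_subset (hSAn j) (hC j)))
          ((dH j).mono Set.inter_subset_right)
    rw [e1, ← marg_marg e2, e3, marg_mul]
    · rw [Set.disjoint_left]
      intro v hv hv'
      exact hv'.2 (Or.inl (Or.inl hv.1))
    · refine dG.mono fun v hv hv' => hv'.2 ?_
      rcases hv with hv | hv
      · exact Or.inl (Or.inl hv)
      · exact Or.inr hv
    · exact (dH j).mono fun v hv hv' => hv.1 hv'.1
  refine ⟨marg G (S \ A)ᶜ, fun x => ∑ j, c j * marg (H j) (N j)ᶜ x, ?_, ?_, ?_⟩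
  · refine ((marg_depOn' dG _).inter (marg_depOn G _)).mono ?_
    intro v
    simp only [Set.mem_union, Set.mem_inter_iff, Set.mem_compl_iff, Set.mem_sdiff]
    tauto
  · refine DepOn.sum fun j _ => DepOn.mul (fun _ _ _ => rfl) ?_
    refine ((marg_depOn' (dH j) _).inter (marg_depOn (H j) _)).mono ?_
    intro v
    simp only [hN, Set.mem_union, Set.mem_inter_iff, Set.mem_compl_iff, Set.mem_sdiff]
    tauto
  · intro x
    rw [marg_sum, Finset.mul_sum]
    refine Finset.sum_congr rfl fun j _ => ?_
    rw [main]
    ring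

theorem mixtureDAG_dir_inl {K : ℕ} {E : Fin K → V → V → Prop} {W : Set V} {j k : Fin K} {u v : V} :
    (mixtureDAG K E W).dir (Sum.inl (j, u)) (Sum.inl (k, v)) ↔ j = k ∧ E j u v := by
  constructor
  · rintro (⟨i, a, b, h, h1, h2⟩ | ⟨i, b, h, h1, h2⟩)
    · simp only [Sum.inl.injEq, Prod.mk.injEq] at h1 h2
      obtain ⟨rfl, rfl⟩ := h1
      obtain ⟨rfl, rfl⟩ := h2
      exact ⟨rfl, h⟩
    · cases h1
  · rintro ⟨rfl, h⟩
    exact Or.inl ⟨j, u, v, h, rfl, rfl⟩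

theorem mixtureDAG_dir_inr {K : ℕ} {E : Fin K → V → V → Prop} {W : Set V} {k : Fin K} {v : V} :
    (mixtureDAG K E W).dir (Sum.inr ()) (Sum.inl (k, v)) ↔ v ∈ W := by
  constructor
  · rintro (⟨i, a, b, h, h1, h2⟩ | ⟨i, b, h, h1, h2⟩)
    · cases h1
    · simp only [Sum.inl.injEq, Prod.mk.injEq] at h2
      obtain ⟨rfl, rfl⟩ := h2
      exact h
  · intro h
    exact Or.inr ⟨k, v, h, rfl, rfl⟩

theorem mixtureDAG_not_dir_inr {K : ℕ} {E : Fin K → V → V → Prop} {W : Set V} {x}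
    : ¬ (mixtureDAG K E W).dir x (Sum.inr ()) := by
  rintro (⟨i, a, b, h, h1, h2⟩ | ⟨i, b, h, h1, h2⟩)
  · cases h2
  · cases h2

theorem mixtureDAG_anc {K : ℕ} {E : Fin K → V → V → Prop} {W : Set V} {j : Fin K} {u : V} {z}
    (h : (mixtureDAG K E W).Anc (Sum.inl (j, u)) z) :
    ∃ v, z = Sum.inl (j, v) ∧ Relation.ReflTransGen (E j) u v := by
  induction h with
  | refl => exact ⟨u, rfl, Relation.ReflTransGen.refl⟩
  | @tail b c _ h ih =>
    obtain ⟨v, rfl, hv⟩ := ih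
    rcases c with ⟨k, c⟩ | ⟨⟩
    · obtain ⟨rfl, hE⟩ := mixtureDAG_dir_inl.1 h
      exact ⟨c, rfl, hv.tail hE⟩
    · exact absurd h mixtureDAG_not_dir_inr

theorem mixtureDAG_acyclic {K : ℕ} {E : Fin K → V → V → Prop} {W : Set V}
    (hdag : ∀ j, (MixedGraph.mk (E j) (fun _ _ => False)).Acyclic) :
    (mixtureDAG K E W).Acyclic := by
  intro x z h hz
  rcases z with ⟨j, v⟩ | ⟨⟩
  · obtain ⟨u, rfl, hu⟩ := mixtureDAG_anc hz
    exact hdag j u v (mixtureDAG_dir_inl.1 h).2 hu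
  · exact mixtureDAG_not_dir_inr h

theorem mem_liftSet {K : ℕ} {A : Set V} {j : Fin K} {v : V} :
    (Sum.inl (j, v) : (Fin K × V) ⊕ Unit) ∈ liftSet K A ↔ v ∈ A := by
  constructor
  · rintro ⟨i, a, ha, h⟩
    simp only [Sum.inl.injEq, Prod.mk.injEq] at h
    rw [h.2]; exact ha
  · intro h
    exact ⟨j, v, h, rfl⟩

theorem inr_notMem_liftSet {K : ℕ} {A : Set V} :
    (Sum.inr () : (Fin K × V) ⊕ Unit) ∉ liftSet K A := by
  rintro ⟨i, a, ha, h⟩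
  cases h

/-- Extraction of the splitting used in `product_form` from moral separation. -/
theorem exists_splitting {K : ℕ} {E : Fin K → V → V → Prop} {W A B C : Set V}
    (hinv : ∀ v, v ∉ W → ∀ j k u, E j u v → E k u v) (j0 : Fin K)
    (hAC : Disjoint A C)
    (D : Set ((Fin K × V) ⊕ Unit)) (hD : D = liftSet K A ∪ liftSet K B ∪ liftSet K C)
    (hy : ∀ a ∈ liftSet K A, ¬ Relation.ReflTransGen
      ((mixtureDAG K E W).moralStep D (liftSet K C)) a (Sum.inr ()))
    (hAB : ∀ a ∈ liftSet K A, ∀ b ∈ liftSet K B, ¬ Relation.ReflTransGen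
      ((mixtureDAG K E W).moralStep D (liftSet K C)) a b) :
    ∃ (S Q : Set V) (An : Fin K → Set V), 
    (∀ j, B ⊆ An j) ∧ (∀ j, C ⊆ An j) ∧
    (∀ j u v, v ∈ An j → E j u v → u ∈ An j) ∧
    A ⊆ S ∧ Disjoint S B ∧ Disjoint S C ∧ (∀ j, S ⊆ An j) ∧
    (∀ j v, v ∈ Q → v ∈ An j ∧ insert v {u | E j u v} ⊆ S ∪ C) ∧
    (∀ j v, v ∈ An j → v ∉ Q → insert v {u | E j u v} ⊆ Sᶜ) ∧
    (∀ v, v ∈ Q → v ∉ W) := by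
  set G := mixtureDAG K E W with hG
  set An : Fin K → Set V := fun j => {v | ∃ z ∈ D, G.Anc (Sum.inl (j, v)) z} with hAn
  have dAC := Set.disjoint_left.1 hAC
  have mA : ∀ j, A ⊆ An j := fun j v hv =>
    ⟨_, by rw [hD]; exact Or.inl (Or.inl (mem_liftSet.2 hv)), Relation.ReflTransGen.refl⟩
  have mB : ∀ j, B ⊆ An j := fun j v hv =>
    ⟨_, by rw [hD]; exact Or.inl (Or.inr (mem_liftSet.2 hv)), Relation.ReflTransGen.refl⟩
  have mC : ∀ j, C ⊆ An j := fun j v hv =>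
    ⟨_, by rw [hD]; exact Or.inr (mem_liftSet.2 hv), Relation.ReflTransGen.refl⟩
  have hanc : ∀ j u v, v ∈ An j → E j u v → u ∈ An j := by
    rintro j u v ⟨z, hz, h⟩ hE
    exact ⟨z, hz, Relation.ReflTransGen.head (mixtureDAG_dir_inl.2 ⟨rfl, hE⟩) h⟩
  have ancW : ∀ j v, v ∈ An j → v ∈ W → G.ancOut D (liftSet K C) (Sum.inr ()) := by
    rintro j v ⟨z, hz, h⟩ hW
    exact ⟨⟨z, hz, Relation.ReflTransGen.head (mixtureDAG_dir_inr.2 hW) h⟩, inr_notMem_liftSet⟩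
  have ancO : ∀ j v, G.ancOut D (liftSet K C) (Sum.inl (j, v)) ↔ v ∈ An j ∧ v ∉ C := by
    intro j v
    unfold ancOut
    rw [mem_liftSet]
    rfl
  set Rch : (Fin K × V) ⊕ Unit → Prop := fun x => ∃ a ∈ liftSet K A,
    Relation.ReflTransGen (G.moralStep D (liftSet K C)) a x with hR
  have Rstep : ∀ x z, Rch x → G.moralStep D (liftSet K C) x z → Rch z := by
    rintro x z ⟨a, ha, h⟩ h'
    exact ⟨a, ha, h.tail h'⟩
  have Ry : ¬ Rch (Sum.inr ()) := fun ⟨a, ha, h⟩ => hy a ha h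
  have Ranc : ∀ x, Rch x → G.ancOut D (liftSet K C) x := by
    rintro x ⟨a, ha, h⟩
    induction h with
    | refl =>
      obtain ⟨j, a, ha, rfl⟩ := ha
      exact (ancO _ _).2 ⟨mA j ha, fun h => dAC ha h⟩
    | tail _ h _ => exact h.2.1
  have Ranc' : ∀ j v, Rch (Sum.inl (j, v)) → v ∈ An j ∧ v ∉ C := fun j v h =>
    (ancO _ _).1 (Ranc _ h)
  -- reached nodes are invariant
  have F0 : ∀ j v, Rch (Sum.inl (j, v)) → v ∉ W := by
    intro j v h hW
    exact Ry (Rstep _ _ h ⟨Ranc _ h, ancW j v (Ranc' j v h).1 hW,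
      Or.inr (Or.inl (mixtureDAG_dir_inr.2 hW))⟩)
  have Fchild : ∀ j v u, Rch (Sum.inl (j, v)) → E j v u → u ∈ An j → u ∉ C →
      Rch (Sum.inl (j, u)) := by
    intro j v u h hE hu hC
    exact Rstep _ _ h ⟨Ranc _ h, (ancO _ _).2 ⟨hu, hC⟩, Or.inl (mixtureDAG_dir_inl.2 ⟨rfl, hE⟩)⟩
  have F1 : ∀ j v u, Rch (Sum.inl (j, v)) → E j v u → u ∈ An j → u ∉ W := by
    intro j v u h hE hu hW
    by_cases hC : u ∈ C
    · exact Ry (Rstep _ _ h ⟨Ranc _ h, ancW j u hu hW, Or.inr (Or.inr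
        ⟨Sum.inl (j, u), mem_liftSet.2 hC, mixtureDAG_dir_inl.2 ⟨rfl, hE⟩,
          mixtureDAG_dir_inr.2 hW⟩)⟩)
    · exact F0 j u (Fchild j v u h hE hu hC) hW
  have F2 : ∀ j v, Rch (Sum.inl (j, v)) → ∀ k, v ∈ An k := by
    intro j v h k
    obtain ⟨⟨z, hz, hvz⟩, -⟩ := Ranc _ h
    obtain ⟨w, rfl, hw⟩ := mixtureDAG_anc hvz
    have hw' : w ∈ An k ∧ w ∈ An j := by
      rw [hD] at hz
      rcases hz with (hz | hz) | hz
      · exact ⟨mA k (mem_liftSet.1 hz), mA j (mem_liftSet.1 hz)⟩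
      · exact ⟨mB k (mem_liftSet.1 hz), mB j (mem_liftSet.1 hz)⟩
      · exact ⟨mC k (mem_liftSet.1 hz), mC j (mem_liftSet.1 hz)⟩
    clear hvz hz
    have : Rch (Sum.inl (j, v)) → v ∈ An k ∧ v ∈ An j := by
      induction hw using Relation.ReflTransGen.head_induction_on with
      | refl => exact fun _ => hw'
      | @head a b hab hbw ih =>
        intro ha
        have hbj : b ∈ An j := by
          clear ih hab ha
          induction hbw using Relation.ReflTransGen.head_induction_on with
          | refl => exact hw'.2
          | @head c d h1 _ ih' => exact hanc j c d ih' h1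
        have haj : a ∈ An j := hanc j a b hbj hab
        have hbW := F1 j a b ha hab hbj
        have hEk := hinv b hbW j k a hab
        refine ⟨hanc k a b ?_ hEk, haj⟩
        by_cases hbC : b ∈ C
        · exact mC k hbC
        · exact (ih (Fchild j a b ha hab hbj hbC) (Fchild j a b ha hab hbj hbC)).1
    exact (this h).1
  have U : ∀ x, Rch x → ∀ j v, x = Sum.inl (j, v) → ∀ k, Rch (Sum.inl (k, v)) := by
    rintro x ⟨a, ha, h⟩
    induction h with
    | refl =>
      rintro j v rfl k
      exact ⟨_, mem_liftSet.2 (mem_liftSet.1 ha), Relation.ReflTransGen.refl⟩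
    | @tail x z hx hxz ih =>
      rintro j v rfl k
      have hxR : Rch x := ⟨a, ha, hx⟩
      have hzR : Rch (Sum.inl (j, v)) := Rstep _ _ hxR hxz
      rcases x with ⟨i, u⟩ | ⟨⟩
      · have hku := ih i u rfl k
        refine Rstep _ _ hku ⟨Ranc _ hku, (ancO _ _).2 ⟨F2 j v hzR k, (Ranc' j v hzR).2⟩, ?_⟩
        rcases hxz.2.2 with h | h | ⟨c, hc, h, h'⟩
        · obtain ⟨rfl, hE⟩ := mixtureDAG_dir_inl.1 h
          exact Or.inl (mixtureDAG_dir_inl.2 ⟨rfl, hinv v (F0 _ _ hzR) _ _ _ hE⟩)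
        · obtain ⟨rfl, hE⟩ := mixtureDAG_dir_inl.1 h
          exact Or.inr (Or.inl (mixtureDAG_dir_inl.2 ⟨rfl, hinv u (F0 _ _ hxR) _ _ _ hE⟩))
        · rcases c with ⟨l, c⟩ | ⟨⟩
          · obtain ⟨rfl, hE⟩ := mixtureDAG_dir_inl.1 h
            obtain ⟨rfl, hE'⟩ := mixtureDAG_dir_inl.1 h'
            have hcC := mem_liftSet.1 hc
            have hcW := F1 _ _ _ hxR hE (mC _ hcC)
            exact Or.inr (Or.inr ⟨Sum.inl (k, c), mem_liftSet.2 hcC,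
              mixtureDAG_dir_inl.2 ⟨rfl, hinv c hcW _ _ _ hE⟩,
              mixtureDAG_dir_inl.2 ⟨rfl, hinv c hcW _ _ _ hE'⟩⟩)
          · exact absurd h mixtureDAG_not_dir_inr
      · exact absurd hxR Ry
  -- the splitting
  have Uk : ∀ v, (∃ j, Rch (Sum.inl (j, v))) → ∀ k, Rch (Sum.inl (k, v)) :=
    fun v ⟨j, h⟩ k => U _ h j v rfl k
  have Qprop : ∀ j v, v ∈ An j → ((∃ i, Rch (Sum.inl (i, v))) ∨
      ∃ u, (∃ i, Rch (Sum.inl (i, u))) ∧ E j u v) →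
      v ∉ W ∧ ((∃ i, Rch (Sum.inl (i, v))) ∨
        (v ∈ C ∧ ∃ u, (∃ i, Rch (Sum.inl (i, u))) ∧ E j u v)) := by
    rintro j v hv (⟨i, h⟩ | ⟨u, hu, hE⟩)
    · exact ⟨F0 i v h, Or.inl ⟨i, h⟩⟩
    · have hj := Uk u hu j
      refine ⟨F1 j u v hj hE hv, ?_⟩
      by_cases hC : v ∈ C
      · exact Or.inr ⟨hC, u, hu, hE⟩
      · exact Or.inl ⟨j, Fchild j u v hj hE hv hC⟩
  refine ⟨{v | ∃ j, Rch (Sum.inl (j, v))},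
    {v | ∃ j, v ∈ An j ∧ ((∃ i, Rch (Sum.inl (i, v))) ∨
      ∃ u, (∃ i, Rch (Sum.inl (i, u))) ∧ E j u v)}, An, mB, mC, hanc, ?_, ?_, ?_, ?_, ?_, ?_, ?_⟩
  · exact fun v hv => ⟨j0, _, mem_liftSet.2 hv, Relation.ReflTransGen.refl⟩
  · rw [Set.disjoint_left]
    rintro v ⟨j, a, ha, h⟩ hB
    exact hAB a ha _ (mem_liftSet.2 hB) h
  · rw [Set.disjoint_left]
    rintro v ⟨j, h⟩ hC
    exact (Ranc' j v h).2 hC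
  · rintro j v ⟨i, h⟩
    exact F2 i v h j
  · rintro k v ⟨j, hv, hq⟩
    obtain ⟨hW, hq | ⟨hC, u, hu, hE⟩⟩ := Qprop j v hv hq
    · have hk := Uk v hq k
      refine ⟨(Ranc' k v hk).1, ?_⟩
      rintro t (rfl | ht)
      · exact Or.inl hq
      · by_cases hC : t ∈ C
        · exact Or.inr hC
        · refine Or.inl ⟨k, Rstep _ _ hk ⟨Ranc _ hk, (ancO _ _).2
            ⟨hanc k t v (Ranc' k v hk).1 ht, hC⟩, Or.inr (Or.inl (mixtureDAG_dir_inl.2 ⟨rfl, ht⟩))⟩⟩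
    · refine ⟨mC k hC, ?_⟩
      have hk := Uk u hu k
      rintro t (rfl | ht)
      · exact Or.inr hC
      · by_cases htC : t ∈ C
        · exact Or.inr htC
        · refine Or.inl ⟨k, Rstep _ _ hk ⟨Ranc _ hk, (ancO _ _).2
            ⟨hanc k t v (mC k hC) ht, htC⟩, Or.inr (Or.inr ⟨Sum.inl (k, v), mem_liftSet.2 hC,
              mixtureDAG_dir_inl.2 ⟨rfl, hinv v hW _ _ _ hE⟩,
              mixtureDAG_dir_inl.2 ⟨rfl, ht⟩⟩)⟩⟩
  · rintro j v hv hQ t ht hS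
    apply hQ
    refine ⟨j, hv, ?_⟩
    rcases ht with rfl | ht
    · exact Or.inl hS
    · exact Or.inr ⟨t, hS, ht⟩
  · rintro v ⟨j, hv, hq⟩
    exact (Qprop j v hv hq).1

theorem wellFounded_of_acyclic {Ed : V → V → Prop}
    (h : (MixedGraph.mk Ed (fun _ _ => False)).Acyclic) : WellFounded (fun a b => Ed b a) := by
  have : IsTrans V (fun a b => Relation.TransGen Ed b a) := ⟨fun a b c h1 h2 => h2.trans h1⟩
  have : Std.Irrefl (fun a b => Relation.TransGen Ed b a) := ⟨fun a ha => by
    obtain ⟨b, hab, hba⟩ := Relation.TransGen.head'_iff.1 ha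
    exact h a b hab hba⟩
  have wf := Finite.wellFounded_of_trans_of_irrefl (fun a b : V => Relation.TransGen Ed b a)
  exact Subrelation.wf (fun h => Relation.TransGen.single h) wf

end Core

/-- Markov property of the mixture DAG: if `[A]` and `[B]` are
d-separated given `[C]` in the mixture DAG `D_μ` (built with `W = V \ V_INV`), then
`X_A ⟂ X_B | X_C` in the mixture distribution `p_μ`. -/
theorem mixture_markov_property
    {V : Type} [Fintype V] [DecidableEq V] {σ : V → Type} [∀ v, Fintype (σ v)]
    {K : ℕ} (E : Fin K → V → V → Prop)
    (hdag : ∀ j, (MixedGraph.mk (E j) (fun _ _ => False)).Acyclic)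
    (p : Fin K → (∀ v, σ v) → ℝ)
    (hpos : ∀ j, IsPositiveDist (p j))
    (hfact : ∀ j, Factorizes (p j) (E j))
    (pJ : Fin K → ℝ) (hpJpos : ∀ j, 0 < pJ j) (hpJsum : ∑ j, pJ j = 1)
    (A B C : Set V) (hAB : Disjoint A B) (hAC : Disjoint A C) (hBC : Disjoint B C)
    (hsep : (mixtureDAG K E {v | ¬ InvariantNode E p v}).DSep
      (liftSet K A) (liftSet K B) (liftSet K C)) :
    CondIndep (fun x => ∑ j, pJ j * p j x) A B C := by
  set W : Set V := {v | ¬ InvariantNode E p v} with hW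
  have hne : Nonempty (Fin K) := by
    by_contra h
    rw [not_nonempty_iff] at h
    simp at hpJsum
  obtain ⟨j0⟩ := hne
  set E' : Fin K → V → V → Prop := fun j u v => E j u v ∧ (v ∉ W → ∀ k, E k u v) with hE'
  have hacE := mixtureDAG_acyclic (W := W) hdag
  have hsepm : ∀ a ∈ liftSet K A, ∀ b ∈ liftSet K B, ¬ Relation.ReflTransGen
      ((mixtureDAG K E' W).moralStep (liftSet K A ∪ liftSet K B ∪ liftSet K C)
        (liftSet K C)) a b := by
    intro a ha b hb h
    refine not_moralReach (G := mixtureDAG K E W) ?_ hacE hsep ha hb (moralReach_mono ?_ h)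
    · rintro u v (h | h) <;> exact h
    · rintro x z (⟨j, u, v, h, h1, h2⟩ | h)
      · exact Or.inl ⟨j, u, v, h.1, h1, h2⟩
      · exact Or.inr h
  have hinv : ∀ v, v ∉ W → ∀ j k u, E' j u v → E' k u v := by
    intro v hv j k u h
    exact ⟨h.2 hv k, h.2⟩
  have hinvf : ∀ v, v ∉ W → InvariantNode E p v := fun v hv => not_not.1 hv
  set f : Fin K → V → (∀ v, σ v) → ℝ := fun j v => condProb (p j) {v} {u | E j u v} with hf
  have hfeq : ∀ v, v ∉ W → ∀ j k, f j v = f k v := fun v hv j k =>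
    funext fun x => hinvf v hv j k x
  have hdep : ∀ j v, DepOn (f j v) (insert v {u | E' j u v}) := by
    intro j v
    by_cases hv : v ∈ W
    · refine (condProb_depOn (p j) v _).mono ?_
      rintro t (rfl | ht)
      · exact Or.inl rfl
      · exact Or.inr ⟨ht, fun h => absurd hv h⟩
    · have h1 : ∀ k, DepOn (f j v) (insert v {u | E k u v}) := fun k => by
        rw [hfeq v hv j k]
        exact condProb_depOn (p k) v _
      refine (DepOn.iInter h1).mono ?_
      intro t ht
      by_cases htv : t = v
      · exact Or.inl htv
      · have : ∀ k, E k t v := fun k => (ht k).resolve_left htv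
        exact Or.inr ⟨this j, fun _ => this⟩
  have hsum : ∀ j v x, marg (f j v) {v}ᶜ x = 1 := by
    intro j v x
    refine condProb_kernel (hpos j).1 ?_ x
    intro h
    exact hdag j v v h Relation.ReflTransGen.refl
  have hwf : ∀ j, WellFounded (fun a b => E' j b a) := fun j =>
    Subrelation.wf (fun h => h.1) (wellFounded_of_acyclic (hdag j))
  have hp : (fun x => ∑ j, pJ j * p j x) = fun x => ∑ j, pJ j * ∏ v, f j v x := by
    funext x
    exact Finset.sum_congr rfl fun j _ => by rw [hfact j x]
  rw [hp]
  by_cases hy : ∀ a ∈ liftSet K A, ¬ Relation.ReflTransGen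
      ((mixtureDAG K E' W).moralStep (liftSet K A ∪ liftSet K B ∪ liftSet K C)
        (liftSet K C)) a (Sum.inr ())
  · obtain ⟨S, Q, An, h1, h2, h3, h4, h5, h6, h7, h8, h9, h10⟩ :=
      exists_splitting hinv j0 hAC _ rfl hy hsepm
    obtain ⟨g, h, hg, hh, hP⟩ := product_form hdep hsum hwf pJ j0 hAB h1 h2 h3 h4 h5 h6 h7 h8 h9
      (fun j k v hv => hfeq v (h10 v hv) j k)
    exact condIndep_of_product hAB hAC hBC hg hh hP
  · push Not at hy
    obtain ⟨a, ha, hay⟩ := hy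
    have hy' : ∀ b ∈ liftSet K B, ¬ Relation.ReflTransGen
        ((mixtureDAG K E' W).moralStep (liftSet K A ∪ liftSet K B ∪ liftSet K C)
          (liftSet K C)) b (Sum.inr ()) :=
      fun b hb hby => hsepm a ha b hb (hay.trans (moralReach_symm hby))
    obtain ⟨S, Q, An, h1, h2, h3, h4, h5, h6, h7, h8, h9, h10⟩ :=
      exists_splitting (B := A) hinv j0 hBC _ (by rw [Set.union_comm (liftSet K A)]) hy'
        (fun b hb a ha h => hsepm a ha b hb (moralReach_symm h))
    obtain ⟨g, h, hg, hh, hP⟩ := product_form hdep hsum hwf pJ j0 hAB.symm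
      h1 h2 h3 h4 h5 h6 h7 h8 h9 (fun j k v hv => hfeq v (h10 v hv) j k)
    have hci := condIndep_of_product hAB.symm hBC hAC hg hh hP
    intro x hx
    rw [Set.union_comm A B, mul_comm]
    exact hci x hx
end

section
/- Assume the component MAGs M^(1), …, M^(K) are compatible with the same poset. Then for all disjoint A, B, C ⊆ V: A and B are d-separated given C in the union graph M_∪ if and only if [A] and [B] are d-separated given [C] in the mixture DAG D_μ. -/
set_option maxHeartbeats 1000000

attribute [local instance] Classical.propDecidable

universe u

open MixedGraph

namespace MixedGraph

section Generic

variable {α : Type u} {G : MixedGraph α}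

/-- One step `x - z` with marks `s` at `x` and `t` at `z` (`true` is an arrowhead). -/
def Stp (G : MixedGraph α) (x : α) (s t : Bool) (z : α) : Prop :=
  match s, t with
  | false, true => G.dir x z
  | true, false => G.dir z x
  | true, true => G.Bid x z
  | false, false => False

def AnS (G : MixedGraph α) (S : Set α) (x : α) : Prop := ∃ z ∈ S, G.Anc x z

def Act (G : MixedGraph α) (C : Set α) (x : α) (t s : Bool) : Prop :=
  if t = true ∧ s = true then G.AnS C x else x ∉ C

/-- `DC B C x s`: there is a d-connecting walk from `x` to `B` whose first mark is `s`. -/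
inductive DC (G : MixedGraph α) (B C : Set α) : α → Bool → Prop
  | nil {b : α} : b ∈ B → DC G B C b false
  | cons {x z : α} {s t s' : Bool} : G.Stp x s t z → DC G B C z s' → G.Act C z t s' →
      DC G B C x s

theorem Walk.junction_iff {C : Set α} {a b : α} (w : G.Walk a b) (t : Bool) (hb : b ∉ C)
    (s : Bool) (hs : s = true ↔ w.arrowAtStart) :
    (w.junctionOK C (t = true) → G.Act C a t s) := by
  cases w <;> cases t <;> cases s <;>
    simp_all [Walk.junctionOK, Walk.arrowAtStart, activeVertex, Act, AnS]

theorem Walk.toDC {B C : Set α} {a b : α} (w : G.Walk a b) (hb : b ∈ B) (hbC : b ∉ C)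
    (h : w.DConn C) : ∃ s, (s = true ↔ w.arrowAtStart) ∧ G.DC B C a s := by
  induction w with
  | nil a => exact ⟨false, by simp [Walk.arrowAtStart], .nil hb⟩
  | consF e w ih =>
    obtain ⟨h1, h2⟩ := h
    obtain ⟨s, hs, hd⟩ := ih hb hbC h2
    refine ⟨false, by simp [Walk.arrowAtStart], .cons (t := true) (s' := s) e hd ?_⟩
    exact w.junction_iff true hbC s hs (by simpa using h1)
  | consB e w ih =>
    obtain ⟨h1, h2⟩ := h
    obtain ⟨s, hs, hd⟩ := ih hb hbC h2
    refine ⟨true, by simp [Walk.arrowAtStart], .cons (t := false) (s' := s) e hd ?_⟩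
    exact w.junction_iff false hbC s hs (by simpa using h1)
  | consBi e w ih =>
    obtain ⟨h1, h2⟩ := h
    obtain ⟨s, hs, hd⟩ := ih hb hbC h2
    refine ⟨true, by simp [Walk.arrowAtStart], .cons (t := true) (s' := s) e hd ?_⟩
    exact w.junction_iff true hbC s hs (by simpa using h1)

theorem AnS.of_dir {S : Set α} {x z : α} (h : G.dir x z) (hz : G.AnS S z) : G.AnS S x := by
  obtain ⟨c, hc, hh⟩ := hz
  exact ⟨c, hc, Relation.ReflTransGen.head h hh⟩

theorem AnS.of_mem {S : Set α} {x : α} (h : x ∈ S) : G.AnS S x := ⟨x, h, .refl⟩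

theorem AnS.mono {S T : Set α} (hST : S ⊆ T) {x : α} (h : G.AnS S x) : G.AnS T x := by
  obtain ⟨z, hz, hh⟩ := h
  exact ⟨z, hST hz, hh⟩

theorem Walk.start_mem {a b : α} (w : G.Walk a b) : a ∈ w.support := by
  cases w <;> simp [Walk.support]

/-- Suffix of a d-connecting walk starting at a vertex `z` of it. -/
theorem Walk.suffix {C : Set α} {a b : α} (w : G.Walk a b) (h : w.DConn C) {t : Prop}
    (hj : w.junctionOK C t) {z : α}
    (hz : z ∈ w.support) : ∃ v : G.Walk z b, v.DConn C ∧ v.support.Sublist w.support ∧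
      (t → v.arrowAtStart → G.AnS C a) ∧
      (¬ v.arrowAtStart → v.junctionOK C False) := by
  induction w generalizing t with
  | nil a =>
    simp [Walk.support] at hz
    subst hz
    exact ⟨.nil _, h, List.Sublist.refl _, by simp [Walk.arrowAtStart],
      by simp [Walk.junctionOK]⟩
  | consF e w ih =>
    rename_i a x b
    by_cases hza : z = a
    · subst hza
      refine ⟨.consF e w, h, List.Sublist.refl _, by simp [Walk.arrowAtStart], ?_⟩
      intro _
      simpa [Walk.junctionOK, activeVertex] using hj
    · have hz' : z ∈ w.support := by simpa [Walk.support, hza] using hz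
      obtain ⟨v, h1, h2, h3, h4⟩ := ih h.2 h.1 hz'
      exact ⟨v, h1, h2.cons _, fun _ hv => (h3 trivial hv).of_dir e, h4⟩
  | consB e w ih =>
    rename_i a x b
    have key : t → G.AnS C a := by
      intro ht
      simpa [Walk.junctionOK, activeVertex, ht, AnS] using hj
    by_cases hza : z = a
    · subst hza
      exact ⟨.consB e w, h, List.Sublist.refl _, fun ht _ => key ht,
        by simp [Walk.arrowAtStart]⟩
    · have hz' : z ∈ w.support := by simpa [Walk.support, hza] using hz
      obtain ⟨v, h1, h2, h3, h4⟩ := ih h.2 h.1 hz'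
      exact ⟨v, h1, h2.cons _, fun ht _ => key ht, h4⟩
  | consBi e w ih =>
    rename_i a x b
    have key : t → G.AnS C a := by
      intro ht
      simpa [Walk.junctionOK, activeVertex, ht, AnS] using hj
    by_cases hza : z = a
    · subst hza
      exact ⟨.consBi e w, h, List.Sublist.refl _, fun ht _ => key ht,
        by simp [Walk.arrowAtStart]⟩
    · have hz' : z ∈ w.support := by simpa [Walk.support, hza] using hz
      obtain ⟨v, h1, h2, h3, h4⟩ := ih h.2 h.1 hz'
      exact ⟨v, h1, h2.cons _, fun ht _ => key ht, h4⟩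

theorem Walk.junction_of {C : Set α} {a b : α} (v : G.Walk a b)
    (h4 : ¬ v.arrowAtStart → v.junctionOK C False) (t : Bool)
    (h5 : v.arrowAtStart → t = true → G.AnS C a)
    (h6 : v.arrowAtStart → t = false → a ∉ C) : v.junctionOK C (t = true) := by
  cases v <;> cases t <;>
    simp_all [Walk.junctionOK, Walk.arrowAtStart, activeVertex, AnS]

theorem DC.toWalk {B C : Set α} {a : α} {s : Bool} (h : G.DC B C a s) :
    ∃ b ∈ B, ∃ w : G.Walk a b, w.IsPath ∧ w.DConn C ∧
      ∀ t, G.Act C a t s → w.junctionOK C (t = true) := by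
  induction h with
  | @nil b hb =>
    exact ⟨b, hb, .nil b, by simp [Walk.IsPath, Walk.support], by simp [Walk.DConn],
      by simp [Walk.junctionOK]⟩
  | @cons x z s t s' e hd ha ih =>
    obtain ⟨b, hb, w, hp, hw, hj⟩ := ih
    have hj := hj t ha
    refine ⟨b, hb, ?_⟩
    by_cases hx : x ∈ w.support
    · obtain ⟨v, h1, h2, h3, h4⟩ := w.suffix hw hj hx
      refine ⟨v, hp.sublist h2, h1, ?_⟩
      intro t' hact
      refine v.junction_of h4 t' ?_ ?_
      · intro hv ht'
        subst ht'
        cases s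
        · cases t
          · exact e.elim
          · exact (h3 rfl hv).of_dir e
        · simpa [Act] using hact
      · intro hv ht'
        subst ht'
        simpa [Act] using hact
    · have hnd : (x :: w.support).Nodup := List.nodup_cons.2 ⟨hx, hp⟩
      cases s <;> cases t
      · exact e.elim
      · refine ⟨.consF e w, hnd, ⟨by simpa using hj, hw⟩, ?_⟩
        intro t' h
        cases t' <;> simpa [Act, Walk.junctionOK, activeVertex, AnS] using h
      · refine ⟨.consB e w, hnd, ⟨by simpa using hj, hw⟩, ?_⟩
        intro t' h
        cases t' <;> simpa [Act, Walk.junctionOK, activeVertex, AnS] using h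
      · refine ⟨.consBi e w, hnd, ⟨by simpa using hj, hw⟩, ?_⟩
        intro t' h
        cases t' <;> simpa [Act, Walk.junctionOK, activeVertex, AnS] using h

theorem not_dsep_iff_DC {A B C : Set α} (hBC : Disjoint B C) :
    ¬ G.DSep A B C ↔ ∃ a ∈ A, ∃ s, G.DC B C a s := by
  constructor
  · intro h
    simp only [DSep, not_forall, not_not] at h
    obtain ⟨a, ha, b, hb, w, -, hw⟩ := h
    obtain ⟨s, -, hd⟩ := w.toDC hb (Set.disjoint_left.1 hBC hb) hw
    exact ⟨a, ha, s, hd⟩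
  · rintro ⟨a, ha, s, hd⟩ h
    obtain ⟨b, hb, w, hp, hw, -⟩ := hd.toWalk
    exact h ha hb w hp hw

/-! Augmented graph criterion. -/

def Into (G : MixedGraph α) (u w : α) : Prop := G.dir u w ∨ G.Bid u w

theorem Bid.symm' {u v : α} (h : G.Bid u v) : G.Bid v u := Or.symm h

inductive CT (G : MixedGraph α) (S : Set α) : α → α → Prop
  | par {x v : α} : G.Into v x → CT G S x v
  | bid {x z v : α} : G.Bid x z → G.AnS S z → CT G S z v → CT G S x v

def Aug (G : MixedGraph α) (S : Set α) (u v : α) : Prop :=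
  G.Into u v ∨ G.Into v u ∨ ∃ x, G.AnS S x ∧ G.Into u x ∧ G.CT S x v

inductive Chain (G : MixedGraph α) (S B C : Set α) : α → Prop
  | nil {b : α} : b ∈ B → Chain G S B C b
  | cons {u v : α} : G.Aug S u v → v ∉ C → G.AnS S v → Chain G S B C v → Chain G S B C u

theorem DC.anS {B C : Set α} {x : α} {s : Bool} (h : G.DC B C x s) :
    s = false → G.AnS (B ∪ C) x := by
  induction h with
  | nil hb => exact fun _ => AnS.of_mem (Or.inl hb)
  | @cons x z s t s' e hd ha ih =>
    rintro rfl
    cases t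
    · exact e.elim
    · cases s'
      · exact (ih rfl).of_dir e
      · have : G.AnS C z := by simpa [Act] using ha
        exact (this.mono Set.subset_union_right).of_dir e

theorem DC.toChain {S B C : Set α} (hS : B ∪ C ⊆ S) {x : α} {s : Bool}
    (h : G.DC B C x s) (hx : G.AnS S x) : (x ∉ C → G.Chain S B C x) ∧
      (s = true → ∃ v, v ∉ C ∧ G.AnS S v ∧ G.CT S x v ∧ G.Chain S B C v) := by
  induction h with
  | nil hb => exact ⟨fun _ => .nil hb, by simp⟩
  | @cons x z s t s' e hd ha ih =>
    have hz : G.AnS S z := by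
      cases t
      · cases s
        · exact e.elim
        · exact hx.of_dir e
      · cases s'
        · exact (hd.anS rfl).mono hS
        · have : G.AnS C z := by simpa [Act] using ha
          exact this.mono (Set.subset_union_right.trans hS)
    obtain ⟨i1, i2⟩ := ih hz
    by_cases hzC : z ∈ C
    · have : t = true ∧ s' = true := by
        by_contra hcon
        simp [Act, hcon] at ha
        exact ha hzC
      obtain ⟨rfl, rfl⟩ := this
      obtain ⟨v, v1, v2, v3, v4⟩ := i2 rfl
      refine ⟨fun _ => .cons (Or.inr (Or.inr ⟨z, hz, ?_, v3⟩)) v1 v2 v4, ?_⟩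
      · cases s
        · exact Or.inl e
        · exact Or.inr e
      · rintro rfl
        exact ⟨v, v1, v2, .bid e hz v3, v4⟩
    · have i1 := i1 hzC
      refine ⟨fun _ => .cons ?_ hzC hz i1, ?_⟩
      · cases s <;> cases t
        · exact e.elim
        · exact Or.inl (Or.inl e)
        · exact Or.inr (Or.inl (Or.inl e))
        · exact Or.inl (Or.inr e)
      · rintro rfl
        refine ⟨z, hzC, hz, .par ?_, i1⟩
        cases t
        · exact Or.inl e
        · exact Or.inr (Bid.symm' e)

def Done (G : MixedGraph α) (A B C : Set α) : Prop := ∃ a ∈ A, ∃ s, G.DC B C a s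

theorem DC.down {B C : Set α} {v b : α} (h : G.Anc v b) (hb : b ∈ B) (hv : ¬ G.AnS C v) :
    G.DC B C v false := by
  induction h using Relation.ReflTransGen.head_induction_on with
  | refl => exact .nil hb
  | head e _ ih =>
    have h2 := fun h => hv (AnS.of_dir e h)
    refine .cons (t := true) (s' := false) e (ih h2) ?_
    simp only [Act]
    simpa using fun h => h2 (AnS.of_mem h)

theorem DC.up {B C : Set α} {v a : α} {s : Bool} (h : G.Anc v a) (hv : ¬ G.AnS C v)
    (hd : G.DC B C v s) : ∃ s, G.DC B C a s := by
  induction h using Relation.ReflTransGen.head_induction_on generalizing s with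
  | refl => exact ⟨s, hd⟩
  | @head x z e _ ih =>
    have h2 := fun h => hv (AnS.of_dir e h)
    refine ih h2 (s := true) (.cons (t := false) e hd ?_)
    simp only [Act]
    simpa using fun h => hv (AnS.of_mem h)

theorem DC.ext' {A B C : Set α} {u v : α} {s s' t : Bool} (hd : G.DC B C v s)
    (e : G.Stp u s' t v) (hv : G.AnS (A ∪ B ∪ C) v) (hC : ¬ (t = true ∧ s = true) → v ∉ C) :
    G.Done A B C ∨ G.DC B C u s' := by
  by_cases hts : t = true ∧ s = true
  · by_cases hvC : G.AnS C v
    · exact Or.inr (.cons e hd (by simpa [Act, hts] using hvC))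
    · obtain ⟨z, hz, hvz⟩ := hv
      rcases hz with (hz | hz) | hz
      · exact Or.inl ⟨z, hz, DC.up hvz hvC hd⟩
      · refine Or.inr (.cons e (DC.down hvz hz hvC) ?_)
        simp only [Act]
        simpa using fun h => hvC (AnS.of_mem h)
      · exact absurd ⟨z, hz, hvz⟩ hvC
  · exact Or.inr (.cons e hd (by simpa only [Act, if_neg hts] using hC hts))

theorem DC.into {A B C : Set α} {u v : α} {s : Bool} (hd : G.DC B C v s)
    (e : G.Into u v) (hv : G.AnS (A ∪ B ∪ C) v) (hC : s ≠ true → v ∉ C) :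
    G.Done A B C ∨ ∃ s, G.DC B C u s := by
  rcases e with e | e
  · rcases hd.ext' (s' := false) (t := true) e hv (by simpa using hC) with h | h
    exacts [Or.inl h, Or.inr ⟨_, h⟩]
  · rcases hd.ext' (s' := true) (t := true) e hv (by simpa using hC) with h | h
    exacts [Or.inl h, Or.inr ⟨_, h⟩]

theorem DC.outof {A B C : Set α} {u v : α} {s : Bool} (hd : G.DC B C v s)
    (e : G.Into v u) (hv : G.AnS (A ∪ B ∪ C) v) (hC : v ∉ C) :
    G.Done A B C ∨ G.DC B C u true := by
  rcases e with e | e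
  · exact hd.ext' (s' := true) (t := false) e hv (fun _ => hC)
  · exact hd.ext' (s' := true) (t := true) (Bid.symm' e) hv (fun _ => hC)

theorem CT.toDC {A B C : Set α} {x v : α} (h : G.CT (A ∪ B ∪ C) x v)
    (hv : G.AnS (A ∪ B ∪ C) v) (hC : v ∉ C) (hd : ∃ s, G.DC B C v s) :
    G.Done A B C ∨ G.DC B C x true := by
  obtain ⟨s, hd⟩ := hd
  induction h with
  | par e => exact hd.outof e hv hC
  | bid e hz _ ih =>
    rcases ih hv hC hd with h | h
    · exact Or.inl h
    · exact h.ext' (s' := true) (t := true) e hz (by simp)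

theorem Chain.toDC {A B C : Set α} {x : α} (h : G.Chain (A ∪ B ∪ C) B C x) :
    G.Done A B C ∨ ∃ s, G.DC B C x s := by
  induction h with
  | nil hb => exact Or.inr ⟨_, .nil hb⟩
  | cons e hC hv _ ih =>
    rcases ih with h | ⟨s, hd⟩
    · exact Or.inl h
    rcases e with e | e | ⟨y, hy, e, hct⟩
    · exact hd.into e hv (fun _ => hC)
    · rcases hd.outof e hv hC with h | h
      exacts [Or.inl h, Or.inr ⟨_, h⟩]
    · rcases hct.toDC hv hC ⟨s, hd⟩ with h | h
      · exact Or.inl h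
      · exact h.into e hy (by simp)

theorem not_dsep_iff_chain {A B C : Set α} (hAC : Disjoint A C) (hBC : Disjoint B C) :
    ¬ G.DSep A B C ↔ ∃ a ∈ A, G.Chain (A ∪ B ∪ C) B C a := by
  rw [not_dsep_iff_DC hBC]
  constructor
  · rintro ⟨a, ha, s, hd⟩
    refine ⟨a, ha, (hd.toChain ?_ (AnS.of_mem (Or.inl (Or.inl ha)))).1
      (Set.disjoint_left.1 hAC ha)⟩
    rintro x (hx | hx)
    exacts [Or.inl (Or.inr hx), Or.inr hx]
  · rintro ⟨a, ha, h⟩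
    rcases h.toDC with h | ⟨s, h⟩
    exacts [h, ⟨a, ha, s, h⟩]

end Generic

end MixedGraph

section Mixture

variable {V : Type u} {K : ℕ} {E : Fin K → V → V → Prop} {W : Set V}

abbrev cAn (E : Fin K → V → V → Prop) (j : Fin K) : V → V → Prop := Relation.ReflTransGen (E j)

theorem comp_inl {j : Fin K} {u v : V} :
    componentDAGEdges E W j (Sum.inl u) (Sum.inl v) ↔ E j u v := by
  simp [componentDAGEdges]

theorem comp_inr {j : Fin K} {v : V} :
    componentDAGEdges E W j (Sum.inr ()) (Sum.inl v) ↔ v ∈ W := by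
  simp [componentDAGEdges]

theorem comp_chPair {j : Fin K} {u v : V} :
    chPair (componentDAGEdges E W j) u v ↔ u ≠ v ∧ u ∈ W ∧ v ∈ W := by
  simp [chPair, comp_inr]

theorem comp_anc {j : Fin K} {u v : V} :
    AncE (componentDAGEdges E W j) (Sum.inl u) (Sum.inl v) ↔ cAn E j u v := by
  constructor
  · intro h
    have : ∀ x, AncE (componentDAGEdges E W j) (Sum.inl u) x →
        ∃ v, x = Sum.inl v ∧ cAn E j u v := by
      intro x hx
      induction hx with
      | refl => exact ⟨u, rfl, .refl⟩
      | tail _ e ih =>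
        obtain ⟨w, rfl, hw⟩ := ih
        rcases e with ⟨a, b, hab, h1, rfl⟩ | ⟨b, _, h1, _⟩
        · cases h1
          exact ⟨b, rfl, hw.tail hab⟩
        · cases h1
    obtain ⟨v', h1, h2⟩ := this _ h
    cases h1
    exact h2
  · intro h
    exact Relation.ReflTransGen.lift Sum.inl (fun a b hab => comp_inl.2 hab) _ _ h

theorem comp_dir {j : Fin K} {t v : V} : (componentMAG E W j).dir t v ↔
    E j t v ∨ (∃ u, E j t u ∧ (u ≠ v ∧ u ∈ W ∧ v ∈ W) ∧ cAn E j u v) ∨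
      ((t ≠ v ∧ t ∈ W ∧ v ∈ W) ∧ cAn E j t v) := by
  simp only [componentMAG, marginalMAG, comp_inl, comp_chPair, comp_anc]

theorem comp_bidir {j : Fin K} {u v : V} : (componentMAG E W j).bidir u v ↔
    (u ≠ v ∧ u ∈ W ∧ v ∈ W) ∧ ¬ cAn E j u v ∧ ¬ cAn E j v u := by
  simp only [componentMAG, marginalMAG, comp_chPair, comp_anc]

theorem cAn_of_dir {j : Fin K} {t v : V} (h : (componentMAG E W j).dir t v) : cAn E j t v := by
  rcases comp_dir.1 h with h | ⟨u, h, -, h2⟩ | ⟨-, h⟩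
  · exact .single h
  · exact .head h h2
  · exact h

theorem comp_Anc_of {j : Fin K} {u v : V} (h : cAn E j u v) :
    (componentMAG E W j).Anc u v :=
  Relation.ReflTransGen.mono (fun _ _ h => comp_dir.2 (Or.inl h)) _ _ h

theorem inv_parents (hW : ∀ v, ParentsVary E v → v ∈ W) {v : V} (hv : v ∉ W) {j : Fin K}
    (k : Fin K) {u : V} (h : E j u v) : E k u v := by
  by_contra hk
  exact hv (hW v fun hall => hk ((hall j k u).1 h))

theorem WW (hcomp : PosetCompatible E W) {u v : V} (hu : u ∈ W) (hv : v ∈ W) {j : Fin K}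
    (k : Fin K) (h : cAn E j u v) : cAn E k u v := by
  obtain ⟨r, hr, h1, h2⟩ := hcomp
  by_cases huv : u = v
  · subst huv
    exact .refl
  have ruv := h1 j u v (comp_Anc_of h) huv
  by_contra hk
  by_cases hk' : cAn E k v u
  · exact irrefl_of r u (trans_of r ruv (h1 k v u (comp_Anc_of hk') (Ne.symm huv)))
  · exact (h2 k u v (comp_bidir.2 ⟨⟨huv, hu, hv⟩, hk, hk'⟩)).1 ruv

theorem WV (hW : ∀ v, ParentsVary E v → v ∈ W) (hcomp : PosetCompatible E W) {u c : V}
    (hu : u ∈ W) {j : Fin K} (k : Fin K) (h : cAn E j u c) : cAn E k u c := by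
  induction h with
  | refl => exact .refl
  | @tail b c hb e ih =>
    by_cases hc : c ∈ W
    · exact WW hcomp hu hc (j := j) k (hb.tail e)
    · exact ih.tail (inv_parents hW hc k e)

theorem union_anc (hW : ∀ v, ParentsVary E v → v ∈ W) (hcomp : PosetCompatible E W)
    (j0 : Fin K) {u c : V} (h : (unionGraph E W).Anc u c) : ∃ j, cAn E j u c := by
  induction h using Relation.ReflTransGen.head_induction_on with
  | refl => exact ⟨j0, .refl⟩
  | @head x z e _ ih =>
    obtain ⟨k, hk⟩ := ih
    obtain ⟨j, e⟩ := e
    by_cases hz : z ∈ W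
    · exact ⟨j, (cAn_of_dir e).trans (WV hW hcomp hz j hk)⟩
    · refine ⟨k, .head (inv_parents hW hz (j := j) k ?_) hk⟩
      rcases comp_dir.1 e with h | ⟨_, _, h, _⟩ | ⟨h, _⟩
      · exact h
      · exact absurd h.2.2 hz
      · exact absurd h.2.2 hz

theorem anc_union {j : Fin K} {u c : V} (h : cAn E j u c) : (unionGraph E W).Anc u c :=
  Relation.ReflTransGen.mono (fun _ _ h => ⟨j, comp_dir.2 (Or.inl h)⟩) _ _ h

def AnJ (E : Fin K → V → V → Prop) (S : Set V) (j : Fin K) (v : V) : Prop :=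
  ∃ s ∈ S, cAn E j v s

theorem union_AnS (hW : ∀ v, ParentsVary E v → v ∈ W) (hcomp : PosetCompatible E W)
    (j0 : Fin K) {S : Set V} {v : V} : (unionGraph E W).AnS S v ↔ ∃ j, AnJ E S j v := by
  constructor
  · rintro ⟨s, hs, h⟩
    obtain ⟨j, hj⟩ := union_anc hW hcomp j0 h
    exact ⟨j, s, hs, hj⟩
  · rintro ⟨j, s, hs, h⟩
    exact ⟨s, hs, anc_union h⟩

theorem AnJ_W (hW : ∀ v, ParentsVary E v → v ∈ W) (hcomp : PosetCompatible E W)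
    {S : Set V} {v : V} (hv : v ∈ W) {j : Fin K} (k : Fin K) (h : AnJ E S j v) :
    AnJ E S k v := by
  obtain ⟨s, hs, h⟩ := h
  exact ⟨s, hs, WV hW hcomp hv k h⟩

theorem AnJ.of_E {S : Set V} {j : Fin K} {u v : V} (e : E j u v) (h : AnJ E S j v) :
    AnJ E S j u := by
  obtain ⟨s, hs, h⟩ := h
  exact ⟨s, hs, .head e h⟩

theorem AnJ.of_an {S : Set V} {j : Fin K} {u v : V} (e : cAn E j u v) (h : AnJ E S j v) :
    AnJ E S j u := by
  obtain ⟨s, hs, h⟩ := h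
  exact ⟨s, hs, e.trans h⟩

/-! The mixture DAG. -/

theorem mix_dir_ll {j k : Fin K} {u v : V} :
    (mixtureDAG K E W).dir (Sum.inl (j, u)) (Sum.inl (k, v)) ↔ j = k ∧ E j u v := by
  simp only [mixtureDAG]
  constructor
  · rintro (⟨i, a, b, h, h1, h2⟩ | ⟨_, _, _, h1, _⟩)
    · cases h1
      cases h2
      exact ⟨rfl, h⟩
    · cases h1
  · rintro ⟨rfl, h⟩
    exact Or.inl ⟨j, u, v, h, rfl, rfl⟩

theorem mix_dir_y {x : (Fin K × V) ⊕ Unit} : ¬ (mixtureDAG K E W).dir x (Sum.inr ()) := by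
  simp [mixtureDAG]

theorem mix_dir_yl {k : Fin K} {v : V} :
    (mixtureDAG K E W).dir (Sum.inr ()) (Sum.inl (k, v)) ↔ v ∈ W := by
  simp [mixtureDAG]

theorem mix_into {x z : (Fin K × V) ⊕ Unit} :
    (mixtureDAG K E W).Into x z ↔ (mixtureDAG K E W).dir x z := by
  simp [Into, Bid, mixtureDAG]

theorem mix_CT {S : Set ((Fin K × V) ⊕ Unit)} {x z : (Fin K × V) ⊕ Unit} :
    (mixtureDAG K E W).CT S x z ↔ (mixtureDAG K E W).dir z x := by
  constructor
  · intro h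
    cases h with
    | par h => exact mix_into.1 h
    | bid h => simp [Bid, mixtureDAG] at h
  · exact fun h => .par (Or.inl h)

theorem mix_Aug {S : Set ((Fin K × V) ⊕ Unit)} {x z : (Fin K × V) ⊕ Unit} :
    (mixtureDAG K E W).Aug S x z ↔ (mixtureDAG K E W).dir x z ∨ (mixtureDAG K E W).dir z x ∨
      ∃ w, (mixtureDAG K E W).AnS S w ∧ (mixtureDAG K E W).dir x w ∧
        (mixtureDAG K E W).dir z w := by
  simp only [Aug, mix_into, mix_CT]

theorem mix_anc {j : Fin K} {u : V} {x : (Fin K × V) ⊕ Unit} :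
    (mixtureDAG K E W).Anc (Sum.inl (j, u)) x ↔ ∃ v, x = Sum.inl (j, v) ∧ cAn E j u v := by
  constructor
  · intro hx
    induction hx with
    | refl => exact ⟨u, rfl, .refl⟩
    | tail _ e ih =>
      obtain ⟨w, rfl, hw⟩ := ih
      rcases e with ⟨i, a, b, hab, h1, rfl⟩ | ⟨_, b, _, h1, _⟩
      · cases h1
        exact ⟨b, rfl, hw.tail hab⟩
      · cases h1
  · rintro ⟨v, rfl, h⟩
    exact Relation.ReflTransGen.lift (fun v => Sum.inl (j, v))
      (fun a b hab => mix_dir_ll.2 ⟨rfl, hab⟩) _ _ h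

theorem mem_lift {A : Set V} {j : Fin K} {v : V} :
    (Sum.inl (j, v) : (Fin K × V) ⊕ Unit) ∈ liftSet K A ↔ v ∈ A := by
  simp [liftSet]

theorem y_lift {A : Set V} : (Sum.inr () : (Fin K × V) ⊕ Unit) ∉ liftSet K A := by
  simp [liftSet]

theorem mix_AnS {S : Set V} {j : Fin K} {v : V} :
    (mixtureDAG K E W).AnS (liftSet K S) (Sum.inl (j, v)) ↔ AnJ E S j v := by
  constructor
  · rintro ⟨z, hz, h⟩
    obtain ⟨s, rfl, h'⟩ := mix_anc.1 h
    exact ⟨s, mem_lift.1 hz, h'⟩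
  · rintro ⟨s, hs, h⟩
    exact ⟨_, mem_lift.2 hs, mix_anc.2 ⟨s, rfl, h⟩⟩

theorem lift_union (A B : Set V) : liftSet K (A ∪ B) = liftSet K A ∪ liftSet K B := by
  ext (⟨j, v⟩ | ⟨⟩)
  · simp [mem_lift]
  · simp [liftSet]

theorem lift_disjoint {A B : Set V} (h : Disjoint A B) :
    Disjoint (liftSet K A) (liftSet K B) := by
  rw [Set.disjoint_left]
  rintro (⟨j, v⟩ | ⟨⟩) h1 h2
  · exact Set.disjoint_left.1 h (mem_lift.1 h1) (mem_lift.1 h2)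
  · exact y_lift h1

/-! From the mixture DAG to the union graph. -/

/-- `u` is a neighbour of `y` in the moral graph (up to choosing a copy). -/
def Nbr (E : Fin K → V → V → Prop) (W S : Set V) (u : V) : Prop :=
  ∃ w j, w ∈ W ∧ AnJ E S j w ∧ (u = w ∨ E j u w)

theorem union_dir_of_E {j : Fin K} {u v : V} (h : E j u v) : (unionGraph E W).dir u v :=
  ⟨j, comp_dir.2 (Or.inl h)⟩

theorem nbr_aug (hcomp : PosetCompatible E W)
    {S : Set V} {u v : V} (hu : Nbr E W S u) (hv : Nbr E W S v) :
    u = v ∨ (unionGraph E W).Aug S u v := by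
  obtain ⟨w, j, hw, aw, hu⟩ := hu
  obtain ⟨z, k, hz, az, hv⟩ := hv
  have aw' : (unionGraph E W).AnS S w := by
    obtain ⟨s, hs, h⟩ := aw
    exact ⟨s, hs, anc_union h⟩
  have az' : (unionGraph E W).AnS S z := by
    obtain ⟨s, hs, h⟩ := az
    exact ⟨s, hs, anc_union h⟩
  have tow : ∀ {j u w z}, w ∈ W → z ∈ W → w ≠ z → cAn E j w z → (u = w ∨ E j u w) →
      (unionGraph E W).Into u z := by
    rintro j u w z hw hz hne han (rfl | h)
    · exact Or.inl ⟨j, comp_dir.2 (Or.inr (Or.inr ⟨⟨hne, hw, hz⟩, han⟩))⟩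
    · exact Or.inl ⟨j, comp_dir.2 (Or.inr (Or.inl ⟨w, h, ⟨hne, hw, hz⟩, han⟩))⟩
  have tod : ∀ {j u w}, E j u w → (unionGraph E W).Into u w := fun h =>
    Or.inl (union_dir_of_E h)
  by_cases hwz : w = z
  · subst hwz
    rcases hu with rfl | hu <;> rcases hv with rfl | hv
    · exact Or.inl rfl
    · exact Or.inr (Or.inr (Or.inl (tod hv)))
    · exact Or.inr (Or.inl (tod hu))
    · exact Or.inr (Or.inr (Or.inr ⟨w, aw', tod hu, .par (tod hv)⟩))
  right
  by_cases h1 : cAn E j w z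
  · have huz := tow hw hz hwz h1 hu
    rcases hv with rfl | hv
    · exact Or.inl huz
    · exact Or.inr (Or.inr ⟨z, az', huz, .par (tod hv)⟩)
  by_cases h2 : cAn E j z w
  · have hvw := tow hz hw (Ne.symm hwz) (WW hcomp hz hw k h2) hv
    rcases hu with rfl | hu
    · exact Or.inr (Or.inl hvw)
    · exact Or.inr (Or.inr ⟨w, aw', tod hu, .par hvw⟩)
  have hb : (unionGraph E W).Bid w z := Or.inl ⟨j, comp_bidir.2 ⟨⟨hwz, hw, hz⟩, h1, h2⟩⟩
  rcases hu with rfl | hu <;> rcases hv with rfl | hv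
  · exact Or.inl (Or.inr hb)
  · exact Or.inr (Or.inr ⟨z, az', Or.inr hb, .par (tod hv)⟩)
  · exact Or.inr (Or.inr ⟨w, aw', tod hu, .par (Or.inr (Bid.symm' hb))⟩)
  · exact Or.inr (Or.inr ⟨w, aw', tod hu, .bid hb az' (.par (tod hv))⟩)

theorem nbr_of_mix {S : Set V} {j : Fin K} {u : V}
    (h : (mixtureDAG K E W).Aug (liftSet K S) (Sum.inl (j, u)) (Sum.inr ()))
    (hu : AnJ E S j u) : Nbr E W S u := by
  rcases mix_Aug.1 h with h | h | ⟨w, hw, h1, h2⟩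
  · exact (mix_dir_y h).elim
  · exact ⟨u, j, mix_dir_yl.1 h, hu, Or.inl rfl⟩
  · rcases w with ⟨i, w⟩ | ⟨⟩
    · obtain ⟨rfl, h3⟩ := mix_dir_ll.1 h1
      exact ⟨w, j, mix_dir_yl.1 h2, mix_AnS.1 hw, Or.inr h3⟩
    · exact (mix_dir_y h1).elim

theorem mix_Aug_symm {S : Set ((Fin K × V) ⊕ Unit)} {x z : (Fin K × V) ⊕ Unit}
    (h : (mixtureDAG K E W).Aug S x z) : (mixtureDAG K E W).Aug S z x := by
  rw [mix_Aug] at h ⊢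
  rcases h with h | h | ⟨w, h, h1, h2⟩
  exacts [Or.inr (Or.inl h), Or.inl h, Or.inr (Or.inr ⟨w, h, h2, h1⟩)]

theorem AnJ.union {S : Set V} {j : Fin K} {v : V} (h : AnJ E S j v) :
    (unionGraph E W).AnS S v := by
  obtain ⟨s, hs, h⟩ := h
  exact ⟨s, hs, anc_union h⟩

theorem chain_mix_union (hcomp : PosetCompatible E W)
    {S B C : Set V} {x : (Fin K × V) ⊕ Unit}
    (h : (mixtureDAG K E W).Chain (liftSet K S) (liftSet K B) (liftSet K C) x) :
    (∀ j u, x = Sum.inl (j, u) → AnJ E S j u → (unionGraph E W).Chain S B C u) ∧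
    (x = Sum.inr () → ∀ u, Nbr E W S u → (unionGraph E W).Chain S B C u) := by
  induction h with
  | nil hb =>
    refine ⟨?_, ?_⟩
    · rintro j u rfl -
      exact .nil (mem_lift.1 hb)
    · rintro rfl
      exact (y_lift hb).elim
  | @cons x z e hC hz _ ih =>
    refine ⟨?_, ?_⟩
    · rintro j u rfl hu
      rcases z with ⟨k, v⟩ | ⟨⟩
      · rw [mem_lift] at hC
        rw [mix_AnS] at hz
        refine .cons ?_ hC hz.union (ih.1 k v rfl hz)
        rcases mix_Aug.1 e with h | h | ⟨w, hw, h1, h2⟩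
        · exact Or.inl (Or.inl (union_dir_of_E (mix_dir_ll.1 h).2))
        · exact Or.inr (Or.inl (Or.inl (union_dir_of_E (mix_dir_ll.1 h).2)))
        · rcases w with ⟨i, w⟩ | ⟨⟩
          · exact Or.inr (Or.inr ⟨w, (mix_AnS.1 hw).union,
              Or.inl (union_dir_of_E (mix_dir_ll.1 h1).2),
              .par (Or.inl (union_dir_of_E (mix_dir_ll.1 h2).2))⟩)
          · exact (mix_dir_y h1).elim
      · exact ih.2 rfl u (nbr_of_mix e hu)
    · rintro rfl u hu
      rcases z with ⟨k, v⟩ | ⟨⟩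
      · rw [mem_lift] at hC
        rw [mix_AnS] at hz
        have hc := ih.1 k v rfl hz
        rcases nbr_aug hcomp hu (nbr_of_mix (mix_Aug_symm e) hz) with rfl | h
        · exact hc
        · exact .cons h hC hz.union hc
      · exact ih.2 rfl u hu

/-! From the union graph to the mixture DAG. -/

def okD (E : Fin K → V → V → Prop) (W S C : Set V) (x : (Fin K × V) ⊕ Unit) : Prop :=
  x ∉ liftSet K C ∧ (mixtureDAG K E W).AnS (liftSet K S) x

def ND (E : Fin K → V → V → Prop) (W S C : Set V) (x z : (Fin K × V) ⊕ Unit) : Prop :=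
  okD E W S C x ∧ okD E W S C z ∧ (mixtureDAG K E W).Aug (liftSet K S) x z

theorem ND.symm' {S C : Set V} {x z : (Fin K × V) ⊕ Unit} (h : ND E W S C x z) :
    ND E W S C z x := ⟨h.2.1, h.1, mix_Aug_symm h.2.2⟩

abbrev RD (E : Fin K → V → V → Prop) (W S C : Set V) := Relation.ReflTransGen (ND E W S C)

theorem RD.symm' {S C : Set V} {x z : (Fin K × V) ⊕ Unit} (h : RD E W S C x z) :
    RD E W S C z x := by
  induction h with
  | refl => exact .refl
  | tail _ e ih => exact .head e.symm' ih

theorem RD.chain {S B C : Set V} {x z : (Fin K × V) ⊕ Unit} (h : RD E W S C x z)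
    (hz : (mixtureDAG K E W).Chain (liftSet K S) (liftSet K B) (liftSet K C) z) :
    (mixtureDAG K E W).Chain (liftSet K S) (liftSet K B) (liftSet K C) x := by
  induction h using Relation.ReflTransGen.head_induction_on with
  | refl => exact hz
  | head e _ ih => exact .cons e.2.2 e.2.1.1 e.2.1.2 ih

theorem okD_l {S C : Set V} {j : Fin K} {u : V} (h : u ∉ C) (h2 : AnJ E S j u) :
    okD E W S C (Sum.inl (j, u)) := ⟨fun h' => h (mem_lift.1 h'), mix_AnS.2 h2⟩

theorem okD_y {S C : Set V} {j : Fin K} {w : V} (hw : w ∈ W) (h2 : AnJ E S j w) :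
    okD E W S C (Sum.inr ()) :=
  ⟨y_lift, AnS.of_dir (mix_dir_yl.2 hw) (mix_AnS.2 h2)⟩

def ConnY (E : Fin K → V → V → Prop) (W S C : Set V) (u : V) : Prop :=
  ∃ j, RD E W S C (Sum.inl (j, u)) (Sum.inr ())

theorem ND_W {S C : Set V} {j : Fin K} {w : V} (hw : w ∈ W) (h2 : AnJ E S j w) (hC : w ∉ C) :
    ND E W S C (Sum.inl (j, w)) (Sum.inr ()) :=
  ⟨okD_l hC h2, okD_y hw h2, mix_Aug.2 (Or.inr (Or.inl (mix_dir_yl.2 hw)))⟩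

theorem ND_toW {S C : Set V} {j : Fin K} {u w : V} (hw : w ∈ W) (h2 : AnJ E S j w)
    (e : E j u w) (hC : u ∉ C) : ND E W S C (Sum.inl (j, u)) (Sum.inr ()) :=
  ⟨okD_l hC (h2.of_E e), okD_y hw h2,
    mix_Aug.2 (Or.inr (Or.inr ⟨Sum.inl (j, w), mix_AnS.2 h2, mix_dir_ll.2 ⟨rfl, e⟩,
      mix_dir_yl.2 hw⟩))⟩

theorem ND_edge {S C : Set V} {j : Fin K} {u v : V} (e : E j u v) (h2 : AnJ E S j v)
    (hu : u ∉ C) (hv : v ∉ C) : ND E W S C (Sum.inl (j, u)) (Sum.inl (j, v)) :=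
  ⟨okD_l hu (h2.of_E e), okD_l hv h2, mix_Aug.2 (Or.inl (mix_dir_ll.2 ⟨rfl, e⟩))⟩

theorem ND_copar {S C : Set V} {j : Fin K} {u v x : V} (e : E j u x) (e' : E j v x)
    (h2 : AnJ E S j x) (hu : u ∉ C) (hv : v ∉ C) :
    ND E W S C (Sum.inl (j, u)) (Sum.inl (j, v)) :=
  ⟨okD_l hu (h2.of_E e), okD_l hv (h2.of_E e'),
    mix_Aug.2 (Or.inr (Or.inr ⟨Sum.inl (j, x), mix_AnS.2 h2, mix_dir_ll.2 ⟨rfl, e⟩,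
      mix_dir_ll.2 ⟨rfl, e'⟩⟩))⟩

theorem all_or_y (hW : ∀ v, ParentsVary E v → v ∈ W) {S C : Set V} (hCS : C ⊆ S)
    {j : Fin K} {u : V} (h : AnJ E S j u) (hu : u ∉ C) :
    (∀ k, AnJ E S k u) ∨ RD E W S C (Sum.inl (j, u)) (Sum.inr ()) := by
  obtain ⟨s, hs, h⟩ := h
  induction h using Relation.ReflTransGen.head_induction_on with
  | refl => exact Or.inl fun k => ⟨s, hs, .refl⟩
  | @head u v e hvs ih =>
    by_cases hv : v ∈ W
    · exact Or.inr (.single (ND_toW hv ⟨s, hs, hvs⟩ e hu))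
    · by_cases hvC : v ∈ C
      · exact Or.inl fun k => ⟨v, hCS hvC, .single (inv_parents hW hv k e)⟩
      · rcases ih hvC with h | h
        · exact Or.inl fun k => (h k).of_E (inv_parents hW hv k e)
        · exact Or.inr (.head (ND_edge e ⟨s, hs, hvs⟩ hu hvC) h)

theorem bid_W {u v : V} (h : (unionGraph E W).Bid u v) : u ∈ W ∧ v ∈ W := by
  rcases h with ⟨j, h⟩ | ⟨j, h⟩
  · exact (comp_bidir.1 h).1.2
  · exact (comp_bidir.1 h).1.2.symm

theorem into_W (hW : ∀ v, ParentsVary E v → v ∈ W) (hcomp : PosetCompatible E W)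
    {S C : Set V} {u w : V} (e : (unionGraph E W).Into u w) (hw : w ∈ W)
    (aw : ∃ j, AnJ E S j w) (hu : u ∉ C) (au : ∃ j, AnJ E S j u) : ConnY E W S C u := by
  obtain ⟨k, aw⟩ := aw
  rcases e with ⟨j, e⟩ | e
  · have aw := AnJ_W hW hcomp hw j aw
    refine ⟨j, .single ?_⟩
    rcases comp_dir.1 e with e | ⟨x, e, hx, h⟩ | ⟨hx, h⟩
    · exact ND_toW hw aw e hu
    · exact ND_toW hx.2.1 (aw.of_an h) e hu
    · exact ND_W hx.2.1 (aw.of_an h) hu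
  · obtain ⟨j, au⟩ := au
    exact ⟨j, .single (ND_W (bid_W e).1 au hu)⟩

theorem into_not_W (hW : ∀ v, ParentsVary E v → v ∈ W)
    {u w : V} (e : (unionGraph E W).Into u w) (hw : w ∉ W) (k : Fin K) : E k u w := by
  rcases e with ⟨j, e⟩ | e
  · rcases comp_dir.1 e with e | ⟨x, e, hx, h⟩ | ⟨hx, h⟩
    · exact inv_parents hW hw k e
    · exact absurd hx.2.2 hw
    · exact absurd hx.2.2 hw
  · exact absurd (bid_W e).2 hw

theorem ct_W (hW : ∀ v, ParentsVary E v → v ∈ W) (hcomp : PosetCompatible E W) (j0 : Fin K)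
    {S C : Set V} {x v : V} (h : (unionGraph E W).CT S x v) (hx : x ∈ W)
    (ax : ∃ j, AnJ E S j x) (hv : v ∉ C) (av : ∃ j, AnJ E S j v) : ConnY E W S C v := by
  induction h with
  | par e => exact into_W hW hcomp e hx ax hv av
  | bid e hz _ ih => exact ih (bid_W e).2 ((union_AnS hW hcomp j0).1 hz) hv av

theorem classify_into (hW : ∀ v, ParentsVary E v → v ∈ W) (hcomp : PosetCompatible E W)
    {S C : Set V} (hCS : C ⊆ S) {u v : V} (e : (unionGraph E W).Into u v)
    (hu : u ∉ C) (hv : v ∉ C) (au : ∃ j, AnJ E S j u) (av : ∃ j, AnJ E S j v) :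
    (∀ j, ND E W S C (Sum.inl (j, u)) (Sum.inl (j, v))) ∨
      (ConnY E W S C u ∧ ConnY E W S C v) := by
  by_cases hvW : v ∈ W
  · refine Or.inr ⟨into_W hW hcomp e hvW av hu au, ?_⟩
    obtain ⟨j, av⟩ := av
    exact ⟨j, .single (ND_W hvW av hv)⟩
  · have e' := into_not_W hW e hvW
    obtain ⟨j, av⟩ := av
    rcases all_or_y hW hCS av hv with h | h
    · exact Or.inl fun k => ND_edge (e' k) (h k) hu hv
    · exact Or.inr ⟨⟨j, .head (ND_edge (e' j) av hu hv) h⟩, ⟨j, h⟩⟩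

theorem classify (hW : ∀ v, ParentsVary E v → v ∈ W) (hcomp : PosetCompatible E W)
    (j0 : Fin K) {S C : Set V} (hCS : C ⊆ S) {u v : V} (e : (unionGraph E W).Aug S u v)
    (hu : u ∉ C) (hv : v ∉ C) (au : ∃ j, AnJ E S j u) (av : ∃ j, AnJ E S j v) :
    (∀ j, ND E W S C (Sum.inl (j, u)) (Sum.inl (j, v))) ∨
      (ConnY E W S C u ∧ ConnY E W S C v) := by
  rcases e with e | e | ⟨x, ax, e, ct⟩
  · exact classify_into hW hcomp hCS e hu hv au av
  · rcases classify_into hW hcomp hCS e hv hu av au with h | h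
    · exact Or.inl fun j => (h j).symm'
    · exact Or.inr h.symm
  · rw [union_AnS hW hcomp j0] at ax
    by_cases hx : x ∈ W
    · exact Or.inr ⟨into_W hW hcomp e hx ax hu au, ct_W hW hcomp j0 ct hx ax hv av⟩
    · have e1 := into_not_W hW e hx
      have e2 : ∀ k, E k v x := by
        cases ct with
        | par e => exact into_not_W hW e hx
        | bid e => exact absurd (bid_W e).1 hx
      by_cases hxC : x ∈ C
      · exact Or.inl fun k => ND_copar (e1 k) (e2 k) ⟨x, hCS hxC, .refl⟩ hu hv
      obtain ⟨j, ax⟩ := ax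
      rcases all_or_y hW hCS ax hxC with h | h
      · exact Or.inl fun k => ND_copar (e1 k) (e2 k) (h k) hu hv
      · exact Or.inr ⟨⟨j, .head (ND_edge (e1 j) ax hu hxC) h⟩,
          ⟨j, .head (ND_edge (e2 j) ax hv hxC) h⟩⟩

theorem chain_union_mix (hW : ∀ v, ParentsVary E v → v ∈ W) (hcomp : PosetCompatible E W)
    (j0 : Fin K) {S B C : Set V} (hCS : C ⊆ S) {u : V}
    (h : (unionGraph E W).Chain S B C u) (hu : u ∉ C) (au : (unionGraph E W).AnS S u) :
    (∀ j, (mixtureDAG K E W).Chain (liftSet K S) (liftSet K B) (liftSet K C)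
        (Sum.inl (j, u))) ∨
    ((mixtureDAG K E W).Chain (liftSet K S) (liftSet K B) (liftSet K C) (Sum.inr ()) ∧
      ∃ j, (mixtureDAG K E W).Chain (liftSet K S) (liftSet K B) (liftSet K C)
        (Sum.inl (j, u))) := by
  induction h with
  | nil hb => exact Or.inl fun j => .nil (mem_lift.2 hb)
  | @cons u v e hv av _ ih =>
    have ih := ih hv av
    rcases classify hW hcomp j0 hCS e hu hv ((union_AnS hW hcomp j0).1 au)
      ((union_AnS hW hcomp j0).1 av) with h | ⟨⟨j, hj⟩, ⟨k, hk⟩⟩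
    · rcases ih with ih | ⟨hy, j, hj⟩
      · exact Or.inl fun j => RD.chain (.single (h j)) (ih j)
      · exact Or.inr ⟨hy, j, RD.chain (.single (h j)) hj⟩
    · have hy : (mixtureDAG K E W).Chain (liftSet K S) (liftSet K B) (liftSet K C)
          (Sum.inr ()) := by
        rcases ih with ih | ih
        · exact RD.chain hk.symm' (ih k)
        · exact ih.1
      exact Or.inr ⟨hy, j, RD.chain hj hy⟩

end Mixture

/-- under poset compatibility of the component MAGs, for all disjoint
`A, B, C ⊆ V`: `A` and `B` are d-separated given `C` in the union graph `M_∪` iff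
`[A]` and `[B]` are d-separated given `[C]` in the mixture DAG `D_μ`. -/
theorem unionGraph_dsep_iff_mixtureDAG_dsep
    {V : Type u} {K : ℕ} (E : Fin K → V → V → Prop)
    (hdag : ∀ j, (MixedGraph.mk (E j) (fun _ _ => False)).Acyclic)
    (W : Set V) (hW : ∀ v, ParentsVary E v → v ∈ W)
    (hcomp : PosetCompatible E W)
    (A B C : Set V) (hAB : Disjoint A B) (hAC : Disjoint A C) (hBC : Disjoint B C) :
    (unionGraph E W).DSep A B C ↔
      (mixtureDAG K E W).DSep (liftSet K A) (liftSet K B) (liftSet K C) := by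
  rw [← not_iff_not, not_dsep_iff_chain hAC hBC,
    not_dsep_iff_chain (lift_disjoint hAC) (lift_disjoint hBC), ← lift_union, ← lift_union]
  constructor
  · rintro ⟨a, ha, h⟩
    have j0 : Nonempty (Fin K) := by
      cases h with
      | nil hb => exact (Set.disjoint_left.1 hAB ha hb).elim
      | cons e =>
        rcases e with (⟨j, _⟩ | ⟨j, _⟩ | ⟨j, _⟩) | (⟨j, _⟩ | ⟨j, _⟩ | ⟨j, _⟩) |
          ⟨_, _, ⟨j, _⟩ | ⟨j, _⟩ | ⟨j, _⟩, _⟩ <;> exact ⟨j⟩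
    obtain ⟨j0⟩ := j0
    rcases chain_union_mix hW hcomp j0 Set.subset_union_right h
      (Set.disjoint_left.1 hAC ha) (AnS.of_mem (Or.inl (Or.inl ha))) with h | ⟨-, j, h⟩
    · exact ⟨_, mem_lift.2 ha, h j0⟩
    · exact ⟨_, mem_lift.2 ha, h⟩
  · rintro ⟨x, hx, h⟩
    rcases x with ⟨j, a⟩ | ⟨⟩
    · have ha := mem_lift.1 hx
      exact ⟨a, ha, (chain_mix_union hcomp h).1 j a rfl ⟨a, Or.inl (Or.inl ha), .refl⟩⟩
    · exact (y_lift hx).elim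
end

section
/- Let A, B, C ⊆ V be disjoint, and for each j let D̃^(j) denote the sub-DAG of the mixture DAG D_μ induced on V^(j) ∪ {y}. Suppose that for every j ∈ {1, …, K}: (a) A^(j) and B^(j) are d-separated given C^(j) in D̃^(j), and (b) A^(j) and {y} are d-separated given C^(j) in D̃^(j). Then the conditional p^(j)(x_A | x_C) is the same for all j (i.e., X_A ⊥ J | X_C in the joint distribution p_μ(x_V, j) = p_J(j) p^(j)(x_V)), and consequently p^(j)(x_A, x_B | x_C) = p^(1)(x_A | x_C) · p^(j)(x_B | x_C) for all j and all states x with positive probability of x_C. -/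
set_option maxHeartbeats 1000000

attribute [local instance] Classical.propDecidable

universe u

open MixedGraph

namespace TechLemma

section GraphPart

variable {X : Type u}

/-- The mixed graph of a directed edge relation. -/
abbrev dg (E : X → X → Prop) : MixedGraph X := MixedGraph.mk E (fun _ _ => False)

/-- Ancestors of a set. -/
def AnS (E : X → X → Prop) (C : Set X) (v : X) : Prop := ∃ z ∈ C, Relation.ReflTransGen E v z

theorem AnS.of_mem {E : X → X → Prop} {C : Set X} {v : X} (h : v ∈ C) : AnS E C v :=
  ⟨v, h, Relation.ReflTransGen.refl⟩

theorem AnS.head {E : X → X → Prop} {C : Set X} {u v : X} (h : E u v) (hv : AnS E C v) :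
    AnS E C u := by
  obtain ⟨z, hz, hp⟩ := hv
  exact ⟨z, hz, Relation.ReflTransGen.head h hp⟩

/-- Bayes-ball reachability from `A` given `C`; the flag says whether the last edge has an
arrowhead at the final vertex. -/
inductive Reach (E : X → X → Prop) (A C : Set X) : Bool → X → Prop
  | start {a : X} (h : a ∈ A) : Reach E A C false a
  | fwd {t : Bool} {a b : X} (r : Reach E A C t a) (h : E a b) (hC : a ∉ C) : Reach E A C true b
  | bwd {a b : X} (r : Reach E A C false a) (h : E b a) (hC : a ∉ C) : Reach E A C false b
  | col {a b : X} (r : Reach E A C true a) (h : E b a) (hC : AnS E C a) : Reach E A C false b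

theorem Reach.map {Y : Type u} {E : X → X → Prop} {E' : Y → Y → Prop} {A C : Set X}
    {A' C' : Set Y} (f : X → Y) (hE : ∀ u v, E u v → E' (f u) (f v))
    (hA : ∀ a ∈ A, f a ∈ A') (hC : ∀ c, f c ∈ C' ↔ c ∈ C) {t : Bool} {v : X}
    (h : Reach E A C t v) : Reach E' A' C' t (f v) := by
  induction h with
  | start h => exact .start (hA _ h)
  | fwd r h hc ih => exact .fwd ih (hE _ _ h) (by rwa [hC])
  | bwd r h hc ih => exact .bwd ih (hE _ _ h) (by rwa [hC])
  | col r h hc ih =>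
    obtain ⟨z, hz, hp⟩ := hc
    exact .col ih (hE _ _ h) ⟨f z, by rwa [hC], Relation.ReflTransGen.lift f hE _ _ hp⟩

theorem reach_walk {E : X → X → Prop} {A C : Set X} (hAC : Disjoint A C) {t : Bool} {v : X}
    (h : Reach E A C t v) : ∀ {b : X} (w : (dg E).Walk v b), w.junctionOK C (t = true) →
    w.DConn C → ∃ a ∈ A, ∃ w' : (dg E).Walk a b, w'.DConn C := by
  induction h with
  | start h => exact fun w _ hw => ⟨_, h, w, hw⟩
  | fwd r h hc ih =>
    intro b w hj hw
    refine ih (.consF h w) ?_ ?_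
    · simp only [Walk.junctionOK, activeVertex]; right; exact ⟨by simp, hc⟩
    · simp only [Walk.DConn]; exact ⟨by simpa using hj, hw⟩
  | bwd r h hc ih =>
    intro b w hj hw
    refine ih (.consB h w) ?_ ?_
    · simp only [Walk.junctionOK, activeVertex]; right; exact ⟨by simp, hc⟩
    · simp only [Walk.DConn]; exact ⟨by simpa using hj, hw⟩
  | col r h hc ih =>
    intro b w hj hw
    refine ih (.consB h w) ?_ ?_
    · simp only [Walk.junctionOK, activeVertex]; left; exact ⟨by simp, hc⟩
    · simp only [Walk.DConn]; exact ⟨by simpa using hj, hw⟩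

theorem suffix_lemma {E : X → X → Prop} {C : Set X} {b c : X} (w : (dg E).Walk b c) :
    ∀ a, a ∈ w.support → a ≠ b → w.IsPath → w.DConn C →
    ∃ q : (dg E).Walk a c, q.IsPath ∧ q.DConn C ∧ ∃ s : Bool, q.junctionOK C (s = true) ∧
      (s = false → w.junctionOK C True → AnS E C b) := by
  induction w with
  | nil b =>
    intro a ha hab
    simp [Walk.support] at ha
    exact absurd ha hab
  | @consF b d c h w ih =>
    intro a ha hab hp hd
    simp only [Walk.support, List.mem_cons, Walk.IsPath, List.nodup_cons, Walk.DConn] at ha hp hd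
    have ha' := ha.resolve_left hab
    by_cases had : a = d
    · subst had
      exact ⟨w, hp.2, hd.2, true, by simpa using hd.1, by simp⟩
    · obtain ⟨q, h1, h2, s, h3, h4⟩ := ih a ha' had hp.2 hd.2
      exact ⟨q, h1, h2, s, h3, fun hs _ => AnS.head h (h4 hs hd.1)⟩
  | @consB b d c h w ih =>
    intro a ha hab hp hd
    simp only [Walk.support, List.mem_cons, Walk.IsPath, List.nodup_cons, Walk.DConn] at ha hp hd
    have ha' := ha.resolve_left hab
    have key : (Walk.consB h w).junctionOK C True → AnS E C b := by
      intro hj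
      simp only [Walk.junctionOK, activeVertex] at hj
      have hj' : ∃ z ∈ C, (dg E).Anc b z := by simpa using hj
      exact hj'
    by_cases had : a = d
    · subst had
      exact ⟨w, hp.2, hd.2, false, by simpa using hd.1, fun _ => key⟩
    · obtain ⟨q, h1, h2, s, h3, h4⟩ := ih a ha' had hp.2 hd.2
      exact ⟨q, h1, h2, s, h3, fun hs => key⟩
  | consBi h w ih =>
    rcases h with h | h <;> exact h.elim

theorem walk_to_path {E : X → X → Prop} {C : Set X} (hirr : ∀ v, ¬ E v v) {b c : X}
    (w : (dg E).Walk b c) : w.DConn C →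
    ∃ q : (dg E).Walk b c, q.IsPath ∧ q.DConn C ∧
      ∀ s : Bool, w.junctionOK C (s = true) → q.junctionOK C (s = true) := by
  induction w with
  | nil b => exact fun _ => ⟨.nil b, by simp [Walk.IsPath, Walk.support], trivial, fun _ h => h⟩
  | @consF b d c h w ih =>
    intro hd
    simp only [Walk.DConn] at hd
    obtain ⟨q, h1, h2, h3⟩ := ih hd.2
    have hq : q.junctionOK C True := by simpa using h3 true (by simpa using hd.1)
    by_cases hb : b ∈ q.support
    · obtain ⟨r, r1, r2, s, r3, r4⟩ := suffix_lemma q b hb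
        (by rintro rfl; exact hirr _ h) h1 h2
      refine ⟨r, r1, r2, ?_⟩
      intro s' hs'
      cases r with
      | nil => trivial
      | consF h' r' =>
        simp only [Walk.junctionOK, activeVertex] at r3 hs' ⊢
        simpa using hs'
      | consB h' r' =>
        simp only [Walk.junctionOK, activeVertex] at r3 hs' ⊢
        cases s' with
        | false => simpa using hs'
        | true =>
          cases s with
          | true => exact r3
          | false =>
            left
            exact ⟨by simp, AnS.head h (r4 rfl hq)⟩
      | consBi h' r' => rcases h' with h | h <;> exact h.elim
    · refine ⟨.consF h q, ?_, ?_, ?_⟩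
      · simp only [Walk.IsPath, Walk.support, List.nodup_cons]; exact ⟨hb, h1⟩
      · simp only [Walk.DConn]; exact ⟨hq, h2⟩
      · intro s hs; exact hs
  | @consB b d c h w ih =>
    intro hd
    simp only [Walk.DConn] at hd
    obtain ⟨q, h1, h2, h3⟩ := ih hd.2
    have hq : q.junctionOK C False := by simpa using h3 false (by simpa using hd.1)
    by_cases hb : b ∈ q.support
    · obtain ⟨r, r1, r2, s, r3, r4⟩ := suffix_lemma q b hb
        (by rintro rfl; exact hirr _ h) h1 h2
      refine ⟨r, r1, r2, ?_⟩
      intro s' hs'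
      cases r with
      | nil => trivial
      | consF h' r' =>
        simp only [Walk.junctionOK, activeVertex] at r3 hs' ⊢
        simpa using r3
      | consB h' r' => exact hs'
      | consBi h' r' => rcases h' with h | h <;> exact h.elim
    · refine ⟨.consB h q, ?_, ?_, ?_⟩
      · simp only [Walk.IsPath, Walk.support, List.nodup_cons]; exact ⟨hb, h1⟩
      · simp only [Walk.DConn]; exact ⟨hq, h2⟩
      · intro s hs; exact hs
  | consBi h w ih =>
    rcases h with h | h <;> exact h.elim

theorem dsep_not_reach {E : X → X → Prop} {A B C : Set X} (hAC : Disjoint A C)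
    (hirr : ∀ v, ¬ E v v) (hs : (dg E).DSep A B C) {t : Bool} {b : X} (hb : b ∈ B) :
    ¬ Reach E A C t b := by
  intro h
  obtain ⟨a, ha, w, hw⟩ := reach_walk hAC h (.nil b) trivial trivial
  obtain ⟨q, h1, h2, -⟩ := walk_to_path hirr w hw
  exact hs ha hb q h1 h2

/-- Active vertices. -/
def Act (E : X → X → Prop) (A C : Set X) (v : X) : Prop :=
  (v ∉ C ∧ Reach E A C false v) ∨ (Reach E A C true v ∧ AnS E C v)

theorem reach_down {E : X → X → Prop} {A C : Set X} {u z : X}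
    (hp : Relation.ReflTransGen E u z) :
    ∀ t, Reach E A C t u → ¬ AnS E C u → ∃ t', Reach E A C t' z := by
  induction hp using Relation.ReflTransGen.head_induction_on with
  | refl => exact fun t h _ => ⟨t, h⟩
  | head h _ ih =>
    intro t hr hn
    exact ih true (.fwd hr h (fun hc => hn (AnS.of_mem hc))) (fun hc => hn (AnS.head h hc))

theorem reach_up {E : X → X → Prop} {A C : Set X} {u z : X}
    (hp : Relation.ReflTransGen E u z) (hz : z ∈ A) :
    ¬ AnS E C u → Reach E A C false u := by
  induction hp using Relation.ReflTransGen.head_induction_on with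
  | refl => exact fun _ => .start hz
  | head h _ ih =>
    intro hn
    have hn' : ¬ AnS E C _ := fun hc => hn (AnS.head h hc)
    exact .bwd (ih hn') h (fun hc => hn' (AnS.of_mem hc))

theorem act_of_reach {E : X → X → Prop} {A B C : Set X}
    (hB : ∀ t, ∀ b ∈ B, ¬ Reach E A C t b) {v : X} (hv : AnS E (A ∪ B ∪ C) v) {t : Bool}
    (hr : Reach E A C t v) (ht : t = true ∨ v ∉ C) : Act E A C v := by
  cases t with
  | false => exact Or.inl ⟨ht.resolve_left (by simp), hr⟩
  | true =>
    by_cases hn : AnS E C v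
    · exact Or.inr ⟨hr, hn⟩
    · obtain ⟨z, (hz | hz) | hz, hp⟩ := hv
      · exact Or.inl ⟨fun h => hn (AnS.of_mem h), reach_up hp hz hn⟩
      · obtain ⟨t', h'⟩ := reach_down hp _ hr hn
        exact absurd h' (hB t' z hz)
      · exact absurd ⟨z, hz, hp⟩ hn

theorem act_parent_reach {E : X → X → Prop} {A C : Set X} {u v : X} (hv : Act E A C v)
    (h : E u v) : Reach E A C false u := by
  rcases hv with ⟨h1, h2⟩ | ⟨h1, h2⟩
  · exact .bwd h2 h h1
  · exact .col h1 h h2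

theorem act_parent {E : X → X → Prop} {A C : Set X} {u v : X} (hv : Act E A C v)
    (h : E u v) (hu : u ∉ C) : Act E A C u := Or.inl ⟨hu, act_parent_reach hv h⟩

theorem act_child {E : X → X → Prop} {A B C : Set X}
    (hB : ∀ t, ∀ b ∈ B, ¬ Reach E A C t b) {u v : X} (hv : AnS E (A ∪ B ∪ C) v)
    (h : E u v) (hu : Act E A C u) (huC : u ∉ C) : Act E A C v := by
  have : ∃ t, Reach E A C t u := by
    rcases hu with h | h
    exacts [⟨_, h.2⟩, ⟨_, h.1⟩]
  obtain ⟨t, ht⟩ := this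
  exact act_of_reach hB hv (.fwd ht h huC) (Or.inl rfl)

theorem AnS.mono {E : X → X → Prop} {C D : Set X} (h : C ⊆ D) {v : X} (hv : AnS E C v) :
    AnS E D v := by
  obtain ⟨z, hz, hp⟩ := hv
  exact ⟨z, h hz, hp⟩

theorem reach_false_an {E : X → X → Prop} {A C : Set X} {t : Bool} {v : X}
    (h : Reach E A C t v) : t = false → AnS E (A ∪ C) v := by
  induction h with
  | start h => exact fun _ => AnS.of_mem (Or.inl h)
  | fwd => simp
  | bwd r h hc ih => exact fun _ => AnS.head h (ih rfl)
  | col r h hc ih => exact fun _ => AnS.head h (hc.mono (by simp))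

theorem act_an {E : X → X → Prop} {A C : Set X} {v : X}
    (h : Act E A C v) : AnS E (A ∪ C) v := by
  rcases h with h | h
  · exact reach_false_an h.2 rfl
  · exact h.2.mono (by simp)

/-- Transfer between two graphs which agree on edges into active vertices. -/
theorem act_an_transfer {E F : X → X → Prop} {A C : Set X}
    (hEF : ∀ u v, Act E A C v → E u v → F u v) {v z : X} {D : Set X} (hCD : C ⊆ D)
    (hDA : D ⊆ A ∪ C)
    (hp : Relation.ReflTransGen E v z) (hz : z ∈ D) : Act E A C v → AnS F D v := by
  induction hp using Relation.ReflTransGen.head_induction_on with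
  | refl => exact fun _ => AnS.of_mem hz
  | @head a b h hp ih =>
    intro ha
    by_cases haC : a ∈ C
    · exact AnS.of_mem (hCD haC)
    have hb : Act E A C b := by
      refine act_child (B := ∅) (by simp) ?_ h ha haC
      have : AnS E D b := ⟨z, hz, hp⟩
      exact this.mono (by simpa using hDA)
    exact AnS.head (hEF _ _ hb h) (ih hb)

theorem reach_transfer {E F : X → X → Prop} {A C : Set X}
    (hEF : ∀ u v, Act E A C v → E u v → F u v) {t : Bool} {v : X}
    (h : Reach E A C t v) : AnS E (A ∪ C) v →
      Reach F A C t v := by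
  have hB : ∀ t, ∀ b ∈ (∅ : Set X), ¬ Reach E A C t b := by simp
  have e : A ∪ ∅ ∪ C = A ∪ C := by simp
  induction h with
  | start h => exact fun _ => .start h
  | @fwd t a b r h hc ih =>
    intro hv
    have hact : Act E A C b := act_of_reach hB (by rwa [e]) (.fwd r h hc) (Or.inl rfl)
    exact .fwd (ih (AnS.head h hv)) (hEF _ _ hact h) hc
  | @bwd a b r h hc ih =>
    intro hv
    exact .bwd (ih (reach_false_an r rfl)) (hEF _ _ (Or.inl ⟨hc, r⟩) h) hc
  | @col a b r h hc ih =>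
    intro hv
    have ha : Act E A C a := Or.inr ⟨r, hc⟩
    obtain ⟨z, hz, hp⟩ := hc
    exact .col (ih (AnS.mono (by simp) ⟨z, hz, hp⟩)) (hEF _ _ ha h)
      (act_an_transfer hEF subset_rfl (by simp) hp hz ha)

theorem act_transfer {E F : X → X → Prop} {A C : Set X}
    (hEF : ∀ u v, Act E A C v → E u v → F u v) {v : X} (h : Act E A C v) : Act F A C v := by
  have han := act_an h
  have h0 := h
  rcases h with h | ⟨h, z, hz, hp⟩
  · exact Or.inl ⟨h.1, reach_transfer hEF h.2 han⟩
  · exact Or.inr ⟨reach_transfer hEF h han, act_an_transfer hEF subset_rfl (by simp) hp hz h0⟩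

end GraphPart

set_option linter.unusedSectionVars false

section ProbPart

variable {V : Type} [Fintype V] [DecidableEq V] {σ : V → Type} [∀ v, Fintype (σ v)]

/-- `f` depends only on the coordinates in `S`. -/
def DepOn (f : (∀ v, σ v) → ℝ) (S : Set V) : Prop :=
  ∀ x y, (∀ v ∈ S, x v = y v) → f x = f y

theorem DepOn.mono {f : (∀ v, σ v) → ℝ} {S T : Set V} (h : DepOn f S) (hST : S ⊆ T) :
    DepOn f T := fun x y hxy => h x y fun v hv => hxy v (hST hv)

theorem DepOn.inter {f : (∀ v, σ v) → ℝ} {S T : Set V} (h : DepOn f S) (h' : DepOn f T) :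
    DepOn f (S ∩ T) := by
  intro x y hxy
  let z : ∀ v, σ v := fun v => if v ∈ S then x v else y v
  rw [h x z (fun v hv => by simp [z, hv])]
  refine h' z y fun v hv => ?_
  by_cases hS : v ∈ S
  · simp [z, hS, hxy v ⟨hS, hv⟩]
  · simp [z, hS]

theorem DepOn.prod {f : V → (∀ v, σ v) → ℝ} {S : Set V} (U : Finset V)
    (h : ∀ v ∈ U, DepOn (f v) S) : DepOn (fun x => ∏ v ∈ U, f v x) S :=
  fun x y hxy => Finset.prod_congr rfl fun v hv => h v hv x y hxy

theorem marg_dep (p : (∀ v, σ v) → ℝ) (S : Set V) : DepOn (marg p S) S := by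
  intro x y hxy
  unfold marg
  refine Finset.sum_congr rfl fun z _ => ?_
  have : (∀ v ∈ S, z v = x v) ↔ (∀ v ∈ S, z v = y v) :=
    forall₂_congr fun v hv => by rw [hxy v hv]
  simp only [this]

theorem condProb_dep (p : (∀ v, σ v) → ℝ) (S C : Set V) : DepOn (condProb p S C) (S ∪ C) := by
  intro x y hxy
  unfold condProb
  rw [marg_dep p (S ∪ C) x y hxy, marg_dep p C x y fun v hv => hxy v (Or.inr hv)]

theorem marg_pos {p : (∀ v, σ v) → ℝ} (hp : ∀ x, 0 < p x) (S : Set V) (x : ∀ v, σ v) :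
    0 < marg p S x := by
  unfold marg
  refine Finset.sum_pos' (fun y _ => ?_) ⟨x, Finset.mem_univ _, ?_⟩
  · split_ifs
    · exact (hp y).le
    · exact le_rfl
  · simp [hp x]

theorem marg_sum (p : (∀ v, σ v) → ℝ) (U : Set V) (v : V) (hv : v ∉ U) (x : ∀ v, σ v) :
    ∑ s : σ v, marg p ({v} ∪ U) (Function.update x v s) = marg p U x := by
  unfold marg
  rw [Finset.sum_comm]
  refine Finset.sum_congr rfl fun y _ => ?_
  rw [Finset.sum_eq_single (y v)]
  · have : (∀ w ∈ ({v} ∪ U : Set V), y w = Function.update x v (y v) w) ↔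
        (∀ w ∈ U, y w = x w) := by
      constructor
      · intro h w hw
        have := h w (Or.inr hw)
        rwa [Function.update_of_ne (by rintro rfl; exact hv hw)] at this
      · rintro h w (hw | hw)
        · obtain rfl : w = v := hw
          simp
        · rw [Function.update_of_ne (by rintro rfl; exact hv hw)]
          exact h w hw
    simp only [this]
  · intro s _ hs
    rw [if_neg]
    intro h
    have := h v (Or.inl rfl)
    simp at this
    exact hs this.symm
  · simp

theorem condProb_sum {p : (∀ v, σ v) → ℝ} (hp : ∀ x, 0 < p x) (U : Set V) (v : V) (hv : v ∉ U)
    (x : ∀ v, σ v) : ∑ s : σ v, condProb p {v} U (Function.update x v s) = 1 := by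
  unfold condProb
  have h : ∀ s, marg p U (Function.update x v s) = marg p U x := fun s =>
    marg_dep p U _ _ fun w hw => Function.update_of_ne (by rintro rfl; exact hv hw) _ _
  simp only [h]
  rw [← Finset.sum_div, marg_sum p U v hv x, div_self (marg_pos hp U x).ne']

theorem marg_prod {p : (∀ v, σ v) → ℝ} {f : V → (∀ v, σ v) → ℝ} {E : V → V → Prop}
    (hac : (dg E).Acyclic) (hpf : ∀ x, p x = ∏ v, f v x)
    (hdep : ∀ v, DepOn (f v) ({v} ∪ {u | E u v}))
    (hsum : ∀ v x, ∑ s : σ v, f v (Function.update x v s) = 1) (n : ℕ) :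
    ∀ (U : Finset V), Uᶜ.card = n → (∀ u v, E u v → v ∈ U → u ∈ U) →
      ∀ x, marg p (U : Set V) x = ∏ v ∈ U, f v x := by
  induction n with
  | zero =>
    intro U hU hcl x
    have : U = Finset.univ := by
      rw [Finset.card_eq_zero] at hU
      rwa [Finset.compl_eq_empty_iff] at hU
    subst this
    rw [← hpf]
    unfold marg
    rw [Finset.sum_eq_single x]
    · simp
    · intro y _ hy
      rw [if_neg]
      intro h
      exact hy (funext fun v => h v (by simp))
    · simp
  | succ n ih =>
    intro U hU hcl x
    have hwf : WellFounded (Relation.TransGen E) := by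
      haveI : Std.Irrefl (Relation.TransGen E) := ⟨by
        intro a ha
        obtain ⟨c, h1, h2⟩ := Relation.TransGen.head'_iff.1 ha
        exact hac a c h1 h2⟩
      exact Finite.wellFounded_of_trans_of_irrefl _
    have hne : (Uᶜ : Finset V).Nonempty := by
      rw [← Finset.card_pos]; omega
    obtain ⟨v, hv, hmin⟩ := hwf.has_min {v | v ∉ U}
      (by obtain ⟨v, hv⟩ := hne; exact ⟨v, by simpa using hv⟩)
    have hvU : v ∉ U := hv
    have hpar : ∀ u, E u v → u ∈ U := by
      intro u hu
      by_contra h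
      exact hmin u h (Relation.TransGen.single hu)
    have hcard : (insert v U)ᶜ.card = n := by
      have h1 := Finset.card_compl_add_card U
      have h2 := Finset.card_compl_add_card (insert v U)
      have h3 := Finset.card_insert_of_notMem hvU
      omega
    have hrec := ih (insert v U) hcard (by
      intro u w huw hw
      rcases Finset.mem_insert.1 hw with rfl | hw
      · exact Finset.mem_insert_of_mem (hpar u huw)
      · exact Finset.mem_insert_of_mem (hcl u w huw hw))
    rw [← marg_sum p (U : Set V) v (by simpa using hvU) x]
    have e : ({v} ∪ (U : Set V)) = ((insert v U : Finset V) : Set V) := by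
      rw [Finset.coe_insert, Set.insert_eq]
    rw [e]
    simp only [hrec, Finset.prod_insert hvU]
    have h4 : ∀ s, ∏ w ∈ U, f w (Function.update x v s) = ∏ w ∈ U, f w x := by
      intro s
      refine Finset.prod_congr rfl fun w hw => hdep w _ _ ?_
      intro u hu
      refine Function.update_of_ne ?_ _ _
      rintro rfl
      rcases hu with hu | hu
      · obtain rfl : u = w := hu
        exact hvU hw
      · exact hvU (hcl _ _ hu hw)
    rw [Finset.sum_congr rfl fun s _ => congrArg (f v (Function.update x v s) * ·) (h4 s),
      ← Finset.sum_mul, hsum, one_mul]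

theorem marg_marg (p : (∀ v, σ v) → ℝ) (S : Set V) (x0 : ∀ v, σ v) :
    ∃ N : ℝ, 0 < N ∧ ∀ (D : Set V), D ⊆ S → ∀ x, marg (marg p S) D x = N * marg p D x := by
  have hcard : ∀ z : ∀ v, σ v, (∑ y : ∀ v, σ v, if ∀ v ∈ S, z v = y v then (1 : ℝ) else 0) =
      ((∏ v, if v ∈ S then 1 else Fintype.card (σ v) : ℕ) : ℝ) := by
    intro z
    rw [Finset.sum_boole]
    congr 1
    have : (Finset.univ.filter fun y : ∀ v, σ v => ∀ v ∈ S, z v = y v) =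
        Fintype.piFinset (fun v => if v ∈ S then {z v} else Finset.univ) := by
      ext y
      simp only [Finset.mem_filter, Finset.mem_univ, true_and, Fintype.mem_piFinset]
      refine forall_congr' fun v => ?_
      by_cases hv : v ∈ S
      · simp [hv, eq_comm]
      · simp [hv]
    rw [this, Fintype.card_piFinset]
    refine Finset.prod_congr rfl fun v _ => ?_
    by_cases hv : v ∈ S <;> simp [hv]
  refine ⟨((∏ v, if v ∈ S then 1 else Fintype.card (σ v) : ℕ) : ℝ), ?_, fun D hD x => ?_⟩
  · rw [Nat.cast_pos]
    refine Finset.prod_pos fun v _ => ?_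
    split_ifs
    · exact one_pos
    · exact Fintype.card_pos_iff.2 ⟨x0 v⟩
  · have h1 : marg (marg p S) D x = ∑ y : ∀ v, σ v, ∑ z : ∀ v, σ v,
        (if ∀ v ∈ D, z v = x v then p z else 0) * (if ∀ v ∈ S, z v = y v then (1 : ℝ) else 0) := by
      unfold marg
      refine Finset.sum_congr rfl fun y _ => ?_
      by_cases hy : ∀ v ∈ D, y v = x v
      · rw [if_pos hy]
        refine Finset.sum_congr rfl fun z _ => ?_
        by_cases hz : ∀ v ∈ S, z v = y v
        · rw [if_pos hz, if_pos hz, if_pos (fun v hv => (hz v (hD hv)).trans (hy v hv)), mul_one]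
        · rw [if_neg hz, if_neg hz, mul_zero]
      · rw [if_neg hy]
        symm
        refine Finset.sum_eq_zero fun z _ => ?_
        by_cases hz : ∀ v ∈ S, z v = y v
        · rw [if_neg (fun h => hy fun v hv => (hz v (hD hv)).symm.trans (h v hv)), zero_mul]
        · rw [if_neg hz, mul_zero]
    rw [h1, Finset.sum_comm]
    simp only [← Finset.mul_sum, hcard]
    rw [← Finset.sum_mul, mul_comm]
    rfl

/-- Coordinates of `y` on `T` and of `z` elsewhere. -/
noncomputable def mix (T : Set V) (y z : ∀ v, σ v) : ∀ v, σ v := fun v => if v ∈ T then y v else z v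

/-- The involution exchanging coordinates outside `T`. -/
noncomputable def mixEquiv (T : Set V) : ((∀ v, σ v) × (∀ v, σ v)) ≃ ((∀ v, σ v) × (∀ v, σ v)) where
  toFun a := (mix T a.1 a.2, mix T a.2 a.1)
  invFun a := (mix T a.1 a.2, mix T a.2 a.1)
  left_inv a := by
    ext v <;> by_cases h : v ∈ T <;> simp [mix, h]
  right_inv a := by
    ext v <;> by_cases h : v ∈ T <;> simp [mix, h]

theorem swap_lemma (q1 q2 r1 r2 : (∀ v, σ v) → ℝ) (T A B C : Set V) (x : ∀ v, σ v)
    (hA : A ⊆ T) (hB : ∀ b ∈ B, b ∉ T)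
    (h : ∀ y z, (∀ v ∈ C, y v = x v) → (∀ v ∈ C, z v = x v) →
      q1 y * q2 z = r1 (mix T y z) * r2 (mix T z y)) :
    marg q1 (A ∪ B ∪ C) x * marg q2 C x = marg r1 (A ∪ C) x * marg r2 (B ∪ C) x := by
  unfold marg
  rw [Finset.sum_mul_sum, Finset.sum_mul_sum, ← Fintype.sum_prod_type', ← Fintype.sum_prod_type']
  refine Fintype.sum_equiv (mixEquiv T) _ _ ?_
  rintro ⟨y, z⟩
  have hiff : ((∀ v ∈ A ∪ B ∪ C, y v = x v) ∧ (∀ v ∈ C, z v = x v)) ↔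
      ((∀ v ∈ A ∪ C, mix T y z v = x v) ∧ (∀ v ∈ B ∪ C, mix T z y v = x v)) := by
    constructor
    · rintro ⟨h1, h2⟩
      constructor
      · rintro v (hv | hv)
        · simp [mix, hA hv, h1 v (Or.inl (Or.inl hv))]
        · by_cases hT : v ∈ T <;> simp [mix, hT, h1 v (Or.inr hv), h2 v hv]
      · rintro v (hv | hv)
        · simp [mix, hB v hv, h1 v (Or.inl (Or.inr hv))]
        · by_cases hT : v ∈ T <;> simp [mix, hT, h1 v (Or.inr hv), h2 v hv]
    · rintro ⟨h1, h2⟩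
      constructor
      · rintro v ((hv | hv) | hv)
        · simpa [mix, hA hv] using h1 v (Or.inl hv)
        · simpa [mix, hB v hv] using h2 v (Or.inl hv)
        · by_cases hT : v ∈ T
          · simpa [mix, hT] using h1 v (Or.inr hv)
          · simpa [mix, hT] using h2 v (Or.inr hv)
      · intro v hv
        by_cases hT : v ∈ T
        · simpa [mix, hT] using h2 v (Or.inr hv)
        · simpa [mix, hT] using h1 v (Or.inr hv)
  have hmul : ∀ (P Q : Prop) [Decidable P] [Decidable Q] (a b : ℝ), (if P then a else 0) * (if Q then b else 0) =
      if P ∧ Q then a * b else 0 := by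
    intro P Q _ _ a b
    by_cases hP : P <;> by_cases hQ : Q <;> simp [hP, hQ]
  rw [hmul, hmul]
  by_cases hc : (∀ v ∈ A ∪ B ∪ C, y v = x v) ∧ (∀ v ∈ C, z v = x v)
  · exact (if_pos hc).trans ((h y z (fun v hv => hc.1 v (Or.inr hv)) hc.2).trans
      (if_pos (hiff.1 hc)).symm)
  · exact (if_neg hc).trans (if_neg (fun hh => hc (hiff.2 hh))).symm

theorem fac_lemma {p : (∀ v, σ v) → ℝ} {f : V → (∀ v, σ v) → ℝ} {E : V → V → Prop}
    (hac : (dg E).Acyclic) (hpf : ∀ x, p x = ∏ v, f v x)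
    (hdep : ∀ v, DepOn (f v) ({v} ∪ {u | E u v}))
    (hsum : ∀ v x, ∑ s : σ v, f v (Function.update x v s) = 1)
    {A B C : Set V} (hB : ∀ t, ∀ b ∈ B, ¬ Reach E A C t b) :
    ∃ h : (∀ v, σ v) → ℝ, DepOn h ({v | Act E A C v}ᶜ ∪ C) ∧
      DepOn (fun x => ∏ v ∈ Finset.univ.filter (fun v => Act E A C v), f v x)
        ({v | Act E A C v} ∪ C) ∧
      ∀ x, marg p {v | AnS E (A ∪ B ∪ C) v} x =
        (∏ v ∈ Finset.univ.filter (fun v => Act E A C v), f v x) * h x := by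
  let S : Finset V := Finset.univ.filter (fun v => AnS E (A ∪ B ∪ C) v)
  have hTS : ∀ v, Act E A C v → AnS E (A ∪ B ∪ C) v := fun v hv =>
    (act_an hv).mono (by rintro v (h | h) <;> simp [h])
  refine ⟨fun x => ∏ v ∈ S.filter (fun v => ¬ Act E A C v), f v x, ?_, ?_, ?_⟩
  · refine DepOn.prod _ fun v hv => (hdep v).mono ?_
    simp only [S, Finset.mem_filter, Finset.mem_univ, true_and] at hv
    rintro u (hu | hu)
    · obtain rfl : u = v := hu
      exact Or.inl hv.2
    · by_cases huC : u ∈ C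
      · exact Or.inr huC
      · exact Or.inl fun hact => hv.2 (act_child hB hv.1 hu hact huC)
  · refine DepOn.prod _ fun v hv => (hdep v).mono ?_
    simp only [Finset.mem_filter, Finset.mem_univ, true_and] at hv
    rintro u (hu | hu)
    · obtain rfl : u = v := hu
      exact Or.inl hv
    · by_cases huC : u ∈ C
      · exact Or.inr huC
      · exact Or.inl (act_parent hv hu huC)
  · intro x
    have e : {v | AnS E (A ∪ B ∪ C) v} = (S : Set V) := by ext; simp [S]
    rw [e, marg_prod hac hpf hdep hsum _ S rfl
      (by intro u v huv hv; simp only [S, Finset.mem_filter, Finset.mem_univ, true_and] at hv ⊢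
          exact AnS.head huv hv) x,
      ← Finset.prod_filter_mul_prod_filter_not S (fun v => Act E A C v)]
    congr 2
    ext v
    simp only [S, Finset.mem_filter, Finset.mem_univ, true_and]
    exact ⟨fun h => h.2, fun h => ⟨hTS v h, h⟩⟩

theorem pair_lemma {p1 p2 : (∀ v, σ v) → ℝ} {f1 f2 : V → (∀ v, σ v) → ℝ} {E1 E2 : V → V → Prop}
    (hac1 : (dg E1).Acyclic) (hpf1 : ∀ x, p1 x = ∏ v, f1 v x)
    (hdep1 : ∀ v, DepOn (f1 v) ({v} ∪ {u | E1 u v}))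
    (hsum1 : ∀ v x, ∑ s : σ v, f1 v (Function.update x v s) = 1)
    (hac2 : (dg E2).Acyclic) (hpf2 : ∀ x, p2 x = ∏ v, f2 v x)
    (hdep2 : ∀ v, DepOn (f2 v) ({v} ∪ {u | E2 u v}))
    (hsum2 : ∀ v x, ∑ s : σ v, f2 v (Function.update x v s) = 1)
    {A B C : Set V} (hAC : Disjoint A C)
    (hB1 : ∀ t, ∀ b ∈ B, ¬ Reach E1 A C t b)
    (hB2 : ∀ t, ∀ b ∈ B, ¬ Reach E2 A C t b)
    (hT : ∀ v, Act E1 A C v ↔ Act E2 A C v)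
    (hf : ∀ v, Act E1 A C v → f1 v = f2 v) (x : ∀ v, σ v) :
    marg p1 (A ∪ C) x * marg p2 C x = marg p2 (A ∪ C) x * marg p1 C x ∧
    marg p1 (A ∪ B ∪ C) x * marg p1 C x = marg p1 (A ∪ C) x * marg p1 (B ∪ C) x := by
  obtain ⟨h1, hd1, gd1, e1⟩ := fac_lemma hac1 hpf1 hdep1 hsum1 hB1
  obtain ⟨h2, hd2, -, e2⟩ := fac_lemma hac2 hpf2 hdep2 hsum2 hB2
  obtain ⟨N1, hN1, m1⟩ := marg_marg p1 {v | AnS E1 (A ∪ B ∪ C) v} x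
  obtain ⟨N2, hN2, m2⟩ := marg_marg p2 {v | AnS E2 (A ∪ B ∪ C) v} x
  simp only [← hT] at hd2 e2
  set T : Set V := {v | Act E1 A C v} with hTdef
  let g : (∀ v, σ v) → ℝ := fun x => ∏ v ∈ Finset.univ.filter (fun v => Act E1 A C v), f1 v x
  have e2' : ∀ x, marg p2 {v | AnS E2 (A ∪ B ∪ C) v} x = g x * h2 x := by
    intro x
    rw [e2]
    congr 1
    refine Finset.prod_congr rfl fun v hv => ?_
    simp only [Finset.mem_filter, Finset.mem_univ, true_and] at hv
    rw [hf v hv]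
  have e1' : ∀ x, marg p1 {v | AnS E1 (A ∪ B ∪ C) v} x = g x * h1 x := e1
  have hg : ∀ y z : ∀ v, σ v, (∀ v ∈ C, y v = x v) → (∀ v ∈ C, z v = x v) →
      g (mix T y z) = g y := by
    intro y z hy hz
    refine gd1 _ _ ?_
    intro v hv
    by_cases h : v ∈ T
    · simp [mix, h]
    · have hc := hv.resolve_left h
      simp [mix, h, hy v hc, hz v hc]
  have hh : ∀ h : (∀ v, σ v) → ℝ, DepOn h (Tᶜ ∪ C) → ∀ y z : ∀ v, σ v,
      (∀ v ∈ C, y v = x v) → (∀ v ∈ C, z v = x v) → h (mix T y z) = h z := by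
    intro k hk y z hy hz
    refine hk _ _ ?_
    intro v hv
    by_cases h : v ∈ T
    · have hc := hv.resolve_left (fun hn => hn h)
      simp [mix, h, hy v hc, hz v hc]
    · simp [mix, h]
  have hAT : A ⊆ T := fun a ha => Or.inl ⟨Set.disjoint_left.1 hAC ha, .start ha⟩
  have hBT : ∀ b ∈ B, b ∉ T := by
    rintro b hb (h | h)
    · exact hB1 _ b hb h.2
    · exact hB1 _ b hb h.1
  have sub : ∀ (E : V → V → Prop) (D : Set V), D ⊆ A ∪ B ∪ C →
      D ⊆ {v | AnS E (A ∪ B ∪ C) v} := fun E D hD v hv => AnS.of_mem (hD hv)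
  have sC : C ⊆ A ∪ B ∪ C := by intro v h; simp [h]
  have sAC : A ∪ C ⊆ A ∪ B ∪ C := by rintro v (h | h) <;> simp [h]
  have sBC : B ∪ C ⊆ A ∪ B ∪ C := by rintro v (h | h) <;> simp [h]
  have N12 : N1 * N2 ≠ 0 := (mul_pos hN1 hN2).ne'
  have N11 : N1 * N1 ≠ 0 := (mul_pos hN1 hN1).ne'
  constructor
  · have key := swap_lemma (marg p1 {v | AnS E1 (A ∪ B ∪ C) v}) (marg p2 {v | AnS E2 (A ∪ B ∪ C) v})
      (marg p2 {v | AnS E2 (A ∪ B ∪ C) v}) (marg p1 {v | AnS E1 (A ∪ B ∪ C) v})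
      T A ∅ C x hAT (by simp) (by
        intro y z hy hz
        rw [e1', e2', e1', e2', hg y z hy hz, hg z y hz hy, hh h2 hd2 y z hy hz,
          hh h1 hd1 z y hz hy]
        ring)
    rw [Set.union_empty, Set.empty_union, m1 _ (sub _ _ sAC), m1 _ (sub _ _ sC),
      m2 _ (sub _ _ sAC), m2 _ (sub _ _ sC)] at key
    apply mul_left_cancel₀ N12
    linear_combination key
  · have key := swap_lemma (marg p1 {v | AnS E1 (A ∪ B ∪ C) v}) (marg p1 {v | AnS E1 (A ∪ B ∪ C) v})
      (marg p1 {v | AnS E1 (A ∪ B ∪ C) v}) (marg p1 {v | AnS E1 (A ∪ B ∪ C) v})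
      T A B C x hAT hBT (by
        intro y z hy hz
        rw [e1', e1', e1', e1', hg y z hy hz, hg z y hz hy, hh h1 hd1 y z hy hz,
          hh h1 hd1 z y hz hy]
        ring)
    rw [m1 _ (sub _ _ subset_rfl), m1 _ (sub _ _ sC),
      m1 _ (sub _ _ sAC), m1 _ (sub _ _ sBC)] at key
    apply mul_left_cancel₀ N11
    linear_combination key

/-- Reduced edge relation: edges into invariant nodes must be shared. -/
def redE (E F : V → V → Prop) (I : V → Prop) (u v : V) : Prop := E u v ∧ (I v → F u v)

theorem reach_comp {K : ℕ} {E : Fin K → V → V → Prop} {W : Set V} {j : Fin K}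
    {F : V → V → Prop} {I : V → Prop} {A C : Set V} {t : Bool} {v : V}
    (h : Reach (redE (E j) F I) A C t v) :
    Reach (componentDAGEdges E W j) (inlSet A) (inlSet C) t (Sum.inl v) := by
  refine Reach.map Sum.inl ?_ ?_ ?_ h
  · intro u v huv
    exact Or.inl ⟨u, v, huv.1, rfl, rfl⟩
  · intro a ha
    exact ⟨a, ha, rfl⟩
  · intro c
    simp [inlSet]

theorem act_inv {K : ℕ} {E : Fin K → V → V → Prop} {W : Set V} {j : Fin K}
    {F : V → V → Prop} {I : V → Prop} {A C : Set V} {v : V}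
    (hy : ∀ t, ¬ Reach (componentDAGEdges E W j) (inlSet A) (inlSet C) t (Sum.inr ()))
    (h : Act (redE (E j) F I) A C v) : v ∉ W := by
  intro hW
  have hedge : componentDAGEdges E W j (Sum.inr ()) (Sum.inl v) := Or.inr ⟨v, hW, rfl, rfl⟩
  rcases h with ⟨h1, h2⟩ | ⟨h1, z, hz, hp⟩
  · exact hy _ (.bwd (reach_comp h2) hedge (by simpa [inlSet] using h1))
  · refine hy _ (.col (reach_comp h1) hedge ⟨Sum.inl z, by simpa [inlSet] using hz, ?_⟩)
    exact Relation.ReflTransGen.lift Sum.inl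
      (fun u v huv => Or.inl ⟨u, v, huv.1, rfl, rfl⟩) _ _ hp

theorem comp_irr {K : ℕ} {E : Fin K → V → V → Prop} {W : Set V} {j : Fin K}
    (hdag : (dg (E j)).Acyclic) : ∀ v, ¬ componentDAGEdges E W j v v := by
  rintro v (⟨a, b, h, h1, h2⟩ | ⟨a, h, h1, h2⟩)
  · rw [h1] at h2
    obtain rfl := Sum.inl_injective h2
    exact hdag _ _ h Relation.ReflTransGen.refl
  · rw [h1] at h2
    cases h2

end ProbPart

end TechLemma
/-- Lemma 1: if for every `j`, `A⁽ʲ⁾` and `B⁽ʲ⁾` are d-separated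
given `C⁽ʲ⁾` in the induced sub-DAG `D̃⁽ʲ⁾` of the mixture DAG, and `A⁽ʲ⁾` and `{y}`
are d-separated given `C⁽ʲ⁾` in `D̃⁽ʲ⁾`, then `p⁽ʲ⁾(x_A | x_C)` is the same for all
`j` (i.e. `X_A ⟂ J | X_C`), and `p⁽ʲ⁾(x_A, x_B | x_C) = p⁽¹⁾(x_A | x_C) · p⁽ʲ⁾(x_B | x_C)`. -/
theorem technical_lemma
    {V : Type} [Fintype V] [DecidableEq V] {σ : V → Type} [∀ v, Fintype (σ v)]
    {K : ℕ} (hK : 0 < K) (E : Fin K → V → V → Prop)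
    (hdag : ∀ j, (MixedGraph.mk (E j) (fun _ _ => False)).Acyclic)
    (p : Fin K → (∀ v, σ v) → ℝ)
    (hpos : ∀ j, IsPositiveDist (p j))
    (hfact : ∀ j, Factorizes (p j) (E j))
    (pJ : Fin K → ℝ) (hpJpos : ∀ j, 0 < pJ j) (hpJsum : ∑ j, pJ j = 1)
    (A B C : Set V) (hAB : Disjoint A B) (hAC : Disjoint A C) (hBC : Disjoint B C)
    (hsepAB : ∀ j, (MixedGraph.mk
        (componentDAGEdges E {v | ¬ InvariantNode E p v} j) (fun _ _ => False)).DSep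
      (inlSet A) (inlSet B) (inlSet C))
    (hsepAy : ∀ j, (MixedGraph.mk
        (componentDAGEdges E {v | ¬ InvariantNode E p v} j) (fun _ _ => False)).DSep
      (inlSet A) {Sum.inr ()} (inlSet C)) :
    (∀ j k x, condProb (p j) A C x = condProb (p k) A C x) ∧
    (∀ j x, 0 < marg (p j) C x →
      condProb (p j) (A ∪ B) C x =
        condProb (p ⟨0, hK⟩) A C x * condProb (p j) B C x) := by
  classical
  have hirr := fun j => TechLemma.comp_irr (W := {v | ¬ InvariantNode E p v}) (hdag j)
  have hAC' : Disjoint (inlSet A) (inlSet C) := by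
    rw [Set.disjoint_left] at hAC ⊢
    rintro _ ⟨a, ha, rfl⟩ ⟨c, hc, h⟩
    obtain rfl := Sum.inl_injective h
    exact hAC ha hc
  have hnB : ∀ j t, ∀ b ∈ B, ¬ TechLemma.Reach
      (componentDAGEdges E {v | ¬ InvariantNode E p v} j) (inlSet A) (inlSet C) t (Sum.inl b) :=
    fun j t b hb => TechLemma.dsep_not_reach hAC' (hirr j) (hsepAB j) ⟨b, hb, rfl⟩
  have hny : ∀ j t, ¬ TechLemma.Reach
      (componentDAGEdges E {v | ¬ InvariantNode E p v} j) (inlSet A) (inlSet C) t (Sum.inr ()) :=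
    fun j t => TechLemma.dsep_not_reach hAC' (hirr j) (hsepAy j) rfl
  have hacy : ∀ j k, (TechLemma.dg (TechLemma.redE (E j) (E k) (InvariantNode E p))).Acyclic := by
    intro j k u v huv hvu
    exact hdag j u v huv.1 (Relation.ReflTransGen.mono (fun _ _ h => h.1) _ _ hvu)
  have hdep : ∀ j k v, TechLemma.DepOn (condProb (p j) {v} {u | E j u v})
      ({v} ∪ {u | TechLemma.redE (E j) (E k) (InvariantNode E p) u v}) := by
    intro j k v
    by_cases hI : InvariantNode E p v
    · have h1 := TechLemma.condProb_dep (p j) {v} {u | E j u v}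
      have h2 := TechLemma.condProb_dep (p k) {v} {u | E k u v}
      rw [← funext (hI j k)] at h2
      refine (h1.inter h2).mono ?_
      rintro u ⟨hu | hu, hu' | hu'⟩
      · exact Or.inl hu
      · exact Or.inl hu
      · exact Or.inl hu'
      · exact Or.inr ⟨hu, fun _ => hu'⟩
    · refine (TechLemma.condProb_dep (p j) {v} {u | E j u v}).mono ?_
      rintro u (hu | hu)
      · exact Or.inl hu
      · exact Or.inr ⟨hu, fun h => absurd h hI⟩
  have hsum : ∀ j v x, ∑ s : σ v, condProb (p j) {v} {u | E j u v} (Function.update x v s) = 1 :=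
    fun j v x => TechLemma.condProb_sum (hpos j).1 {u | E j u v} v
      (fun h => hdag j v v h Relation.ReflTransGen.refl) x
  have hinv : ∀ j k v, TechLemma.Act (TechLemma.redE (E j) (E k) (InvariantNode E p)) A C v →
      InvariantNode E p v := by
    intro j k v hv
    have := TechLemma.act_inv (hny j) hv
    simpa using this
  have htr : ∀ j k v, TechLemma.Act (TechLemma.redE (E j) (E k) (InvariantNode E p)) A C v →
      TechLemma.Act (TechLemma.redE (E k) (E j) (InvariantNode E p)) A C v := by
    intro j k v hv
    refine TechLemma.act_transfer ?_ hv
    intro u w hw huw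
    exact ⟨huw.2 (hinv j k w hw), fun _ => huw.1⟩
  have main := fun j k x => TechLemma.pair_lemma (hacy j k) (hfact j) (hdep j k) (hsum j)
    (hacy k j) (hfact k) (hdep k j) (hsum k) hAC
    (fun t b hb h => hnB j t b hb (TechLemma.reach_comp h))
    (fun t b hb h => hnB k t b hb (TechLemma.reach_comp h))
    (fun v => ⟨htr j k v, htr k j v⟩)
    (fun v hv => funext (hinv j k v hv j k)) x
  have hne : ∀ j x, marg (p j) C x ≠ 0 := fun j x => (TechLemma.marg_pos (hpos j).1 C x).ne'
  have part1 : ∀ j k x, condProb (p j) A C x = condProb (p k) A C x := by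
    intro j k x
    unfold condProb
    rw [div_eq_div_iff (hne j x) (hne k x)]
    exact (main j k x).1
  refine ⟨part1, fun j x _ => ?_⟩
  rw [part1 ⟨0, hK⟩ j x]
  unfold condProb
  rw [div_mul_div_comm, div_eq_div_iff (hne j x) (mul_ne_zero (hne j x) (hne j x))]
  have := (main j j x).2
  linear_combination (marg (p j) C x) * this
end
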